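/- arXiv:1705.01594 — 2 statements merged into one kernel-verified Lean document; each statement's English description precedes it below -/
import Mathlib

section
/- Let (R, m) be a commutative Noetherian local ring, I an ideal of R with cd(I, R) = n, and M an R-module with Supp M ⊆ V(I). Then M is I-cofinite if and only if Tor_i^R(R/I, M) is finitely generated for all 0 ≤ i ≤ n. -/
open CategoryTheory

noncomputable section

universe u

/-- `Tor_i^R(A, B)` as an object of `ModuleCat R`. -/
def TorMod (R : Type u) [CommRing R] (i : ℕ) (A B : ModuleCat.{u} R) : ModuleCat.{u} R :=
  ((Tor (ModuleCat.{u} R) i).obj A).obj B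

/-- `Ext^i_R(A, B)` as an object of `ModuleCat R`. -/
def ExtMod (R : Type u) [CommRing R] (i : ℕ) (A B : ModuleCat.{u} R) : ModuleCat.{u} R :=
  ((Ext R (ModuleCat.{u} R) i).obj (Opposite.op A)).obj B

/-- `H^i_I(M)`, the `i`-th local cohomology of `M` with support in `I`. -/
def LC (R : Type u) [CommRing R] (I : Ideal R) (i : ℕ) (M : ModuleCat.{u} R) : ModuleCat.{u} R :=
  (localCohomology I i).obj M

/-- `M` is `I`-cofinite: `Supp M ⊆ V(I)` and all `Ext^i_R(R/I, M)` are finitely generated. -/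
def IsCofinite (R : Type u) [CommRing R] (I : Ideal R) (M : ModuleCat.{u} R) : Prop :=
  Module.support R M ⊆ PrimeSpectrum.zeroLocus (I : Set R) ∧
    ∀ i : ℕ, Module.Finite R (ExtMod R i (ModuleCat.of R (R ⧸ I)) M)

/-- `Γ_I(M) = ⋃ₙ (0 :_M Iⁿ)`, the `I`-torsion submodule of `M`. -/
def torsionGamma (R : Type u) [CommRing R] (I : Ideal R) (M : Type u) [AddCommGroup M]
    [Module R M] : Submodule R M :=
  ⨆ n : ℕ, Submodule.torsionBySet R M ((I ^ n : Ideal R) : Set R)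

section
open Limits

namespace Cof

variable {R : Type u} [CommRing R]

/-- The projection `R/b → R/a` for `b ≤ a`. -/
def pj {a b : Ideal R} (h : b ≤ a) : ModuleCat.of R (R ⧸ b) ⟶ ModuleCat.of R (R ⧸ a) :=
  ModuleCat.ofHom (Submodule.mapQ b a LinearMap.id h)

lemma pj_comp {a b c : Ideal R} (h : b ≤ a) (h' : c ≤ b) :
    pj h' ≫ pj h = pj (h'.trans h) := by
  ext
  rfl

abbrev pb {A B D : ModuleCat.{u} R} {j : ℕ} (f : A ⟶ B) (e : Abelian.Ext B D j) :
    Abelian.Ext A D j := (Abelian.Ext.mk₀ f).comp e (zero_add j)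

lemma pb_comp {A B C D : ModuleCat.{u} R} {j : ℕ} (f : A ⟶ B) (g : B ⟶ C)
    (e : Abelian.Ext C D j) : pb (f ≫ g) e = pb f (pb g e) := by
  simp [pb]

lemma pb_zero {A B D : ModuleCat.{u} R} {j : ℕ} (f : A ⟶ B) :
    pb f (0 : Abelian.Ext B D j) = 0 := by
  simp [pb]

/-- "the `j`-th local cohomology of `D` vanishes". -/
def Van (I : Ideal R) (j : ℕ) (D : ModuleCat.{u} R) : Prop :=
  ∀ (a : Ideal R) (t : ℕ), I ^ t ≤ a → ∀ e : Abelian.Ext (ModuleCat.of R (R ⧸ a)) D j,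
    ∃ (s : ℕ) (h : I ^ s ≤ a), pb (pj h) e = 0

lemma van_of {I : Ideal R} {j : ℕ} {D : ModuleCat.{u} R} {a b : Ideal R} (h : b ≤ a)
    {e : Abelian.Ext (ModuleCat.of R (R ⧸ a)) D j} (he : pb (pj h) e = 0) {s : ℕ}
    (hs : I ^ s ≤ b) : pb (pj (hs.trans h)) e = 0 := by
  rw [← pj_comp h hs, pb_comp, he, pb_zero]

lemma van_nil (j : ℕ) (hj : 0 < j) (D : ModuleCat.{u} R) : Van (⊥ : Ideal R) j D := by
  intro a t ht e
  refine ⟨1, by simp, ?_⟩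
  obtain ⟨k, rfl⟩ : ∃ k, j = k + 1 := ⟨j - 1, by omega⟩
  have e1 : ((⊥ : Ideal R) ^ 1) = ⊥ := pow_one _
  have : Module.Projective R (R ⧸ ((⊥ : Ideal R) ^ 1)) :=
    Module.Projective.of_equiv (Submodule.quotEquivOfEqBot _ e1).symm
  have : Projective (ModuleCat.of R (R ⧸ ((⊥ : Ideal R) ^ 1))) :=
    (IsProjective.iff_projective _).1 this
  exact Abelian.Ext.eq_zero_of_projective _

/-- the submodule `x^u (R/b)` -/
abbrev KK (b c : Ideal R) (h : b ≤ c) : Submodule R (R ⧸ b) :=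
  LinearMap.ker (Submodule.mapQ b c LinearMap.id h)

abbrev SS {b c : Ideal R} (h : b ≤ c) : ShortComplex (ModuleCat.{u} R) :=
  (Submodule.mapQ b c LinearMap.id h).shortComplexKer

lemma SS_exact {b c : Ideal R} (h : b ≤ c) : (SS h).ShortExact :=
  LinearMap.shortExact_shortComplexKer (fun y => by
    obtain ⟨y, rfl⟩ := Submodule.mkQ_surjective _ y
    exact ⟨Submodule.Quotient.mk y, rfl⟩)

/-- map of the short exact sequences -/
def SSmap {b c b' c' : Ideal R} (h : b ≤ c) (h' : b' ≤ c') (hb : b' ≤ b) (hc : c' ≤ c) :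
    SS h' ⟶ SS h where
  τ₁ := ModuleCat.ofHom ((Submodule.mapQ b' b LinearMap.id hb).restrict (p := KK b' c' h')
      (q := KK b c h) (by
      intro x hx
      obtain ⟨x, rfl⟩ := Submodule.mkQ_surjective _ x
      have hx' : (Submodule.Quotient.mk x : R ⧸ c') = 0 := hx
      have : (Submodule.Quotient.mk x : R ⧸ c) = 0 := by
        rw [Submodule.Quotient.mk_eq_zero] at hx' ⊢
        exact hc hx'
      exact this))
  τ₂ := pj hb
  τ₃ := pj hc
  comm₁₂ := by
    ext
    rfl
  comm₂₃ := by
    ext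
    rfl

/-- multiplication `R/b → x^u (R/b)`. -/
def mm {b c : Ideal R} (h : b ≤ c) (y : R) (hy : y ∈ c) :
    ModuleCat.of R (R ⧸ b) ⟶ ModuleCat.of R (KK b c h) :=
  ModuleCat.ofHom ((LinearMap.lsmul R (R ⧸ b) y).codRestrict _ (by
    intro x
    obtain ⟨x, rfl⟩ := Submodule.mkQ_surjective _ x
    have : (Submodule.Quotient.mk (y * x) : R ⧸ c) = 0 := by
      rw [Submodule.Quotient.mk_eq_zero]
      exact c.mul_mem_right _ hy
    exact this))


lemma mm_surj {b : Ideal R} (y : R) (h : b ≤ b ⊔ Ideal.span {y})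
    (hy : y ∈ b ⊔ Ideal.span {y}) : Function.Surjective (mm h y hy) := by
  rintro ⟨x, hx⟩
  obtain ⟨x, rfl⟩ := Submodule.mkQ_surjective _ x
  have hx' : (Submodule.Quotient.mk x : R ⧸ (b ⊔ Ideal.span {y})) = 0 := hx
  rw [Submodule.Quotient.mk_eq_zero] at hx'
  obtain ⟨z, hz, w, hw, rfl⟩ := Submodule.mem_sup.1 hx'
  obtain ⟨r, rfl⟩ := Ideal.mem_span_singleton'.1 hw
  refine ⟨Submodule.Quotient.mk r, Subtype.ext ?_⟩
  change (Submodule.Quotient.mk (y * r) : R ⧸ b) = Submodule.Quotient.mk (z + r * y)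
  rw [Submodule.Quotient.eq]
  have : y * r - (z + r * y) = - z := by ring
  rw [this]
  exact b.neg_mem hz

lemma exists_q {b : Ideal R} (y z : R) (h : b ≤ b ⊔ Ideal.span {z})
    (hz : z ∈ b ⊔ Ideal.span {z}) (hyz : ∀ r, z * r ∈ b → y * r ∈ b) :
    ∃ q : ModuleCat.of R (KK b _ h) ⟶ ModuleCat.of R (R ⧸ b),
      mm h z hz ≫ q = ModuleCat.ofHom (LinearMap.lsmul R (R ⧸ b) y) := by
  have hs := mm_surj z h hz
  let m := (mm h z hz).hom
  have hk : LinearMap.ker m ≤ LinearMap.ker (LinearMap.lsmul R (R ⧸ b) y) := by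
    intro x hx
    obtain ⟨x, rfl⟩ := Submodule.mkQ_surjective _ x
    have h1 : (Submodule.Quotient.mk (z * x) : R ⧸ b) = 0 := congrArg Subtype.val hx
    have h2 : (Submodule.Quotient.mk (y * x) : R ⧸ b) = 0 := by
      rw [Submodule.Quotient.mk_eq_zero] at h1 ⊢
      exact hyz _ h1
    exact h2
  refine ⟨ModuleCat.ofHom (((LinearMap.ker m).liftQ _ hk).comp
    (m.quotKerEquivOfSurjective hs).symm.toLinearMap), ?_⟩
  ext1
  apply LinearMap.ext
  intro x
  change (LinearMap.ker m).liftQ _ hk ((m.quotKerEquivOfSurjective hs).symm (m x)) = _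
  have : (m.quotKerEquivOfSurjective hs).symm (m x) = Submodule.Quotient.mk x := by
    rw [LinearEquiv.symm_apply_eq]
    rfl
  rw [this]
  rfl

lemma exists_stable [IsNoetherianRing R] (b : Ideal R) (x : R) :
    ∃ N : ℕ, ∀ u, N ≤ u → ∀ v r, x ^ v * r ∈ b → x ^ u * r ∈ b := by
  let f : ℕ →o Ideal R :=
    { toFun := fun n => Submodule.comap (LinearMap.lsmul R R (x ^ n)) b
      monotone' := by
        intro m n hmn r hr
        have hr' : x ^ m * r ∈ b := hr
        have : x ^ n * r ∈ b := by
          rw [← Nat.sub_add_cancel hmn, pow_add, mul_assoc]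
          exact b.mul_mem_left _ hr'
        exact this }
  obtain ⟨N, hN⟩ := monotone_stabilizes_iff_noetherian.2 (inferInstance : IsNoetherian R R) f
  refine ⟨N, fun u hu v r hr => ?_⟩
  have h1 : r ∈ f (max u v) := f.monotone (le_max_right u v) hr
  rw [← hN _ (hu.trans (le_max_left u v)), hN u hu] at h1
  exact h1

lemma van_cons [IsNoetherianRing R] (J : Ideal R) (x : R) (k : ℕ) (D : ModuleCat.{u} R)
    (h1 : Van J (k + 1) D) (h2 : Van J (k + 2) D) : Van (Ideal.span {x} ⊔ J) (k + 2) D := by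
  intro a t ht e
  have hJ : J ^ t ≤ a := (Ideal.pow_right_mono le_sup_right t).trans ht
  have hx : x ^ t ∈ a := ht (Ideal.pow_mem_pow (Ideal.mem_sup_left
    (Ideal.mem_span_singleton_self x)) t)
  obtain ⟨s₁, hs₁, he₁⟩ := h2 a t hJ e
  set b₁ := J ^ s₁ with hb₁
  have hbc₁ : b₁ ≤ b₁ ⊔ Ideal.span {x ^ t} := le_sup_left
  have hxc₁ : x ^ t ∈ b₁ ⊔ Ideal.span {x ^ t} :=
    Ideal.mem_sup_right (Ideal.mem_span_singleton_self _)
  have hca : b₁ ⊔ Ideal.span {x ^ t} ≤ a :=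
    sup_le hs₁ ((Ideal.span_singleton_le_iff_mem _).2 hx)
  obtain ⟨e', he'⟩ := Abelian.Ext.contravariant_sequence_exact₃ (SS_exact hbc₁) D
    (pb (pj hca) e) (by
      have : pb (pj hbc₁) (pb (pj hca) e) = 0 := by
        rw [← pb_comp, pj_comp]
        exact he₁
      exact this) (n₀ := k + 1) (by omega)
  obtain ⟨s₂, hs₂, he₂⟩ := h1 b₁ s₁ le_rfl (pb (mm hbc₁ _ hxc₁) e')
  set b₂ := J ^ s₂ with hb₂
  obtain ⟨N, hN⟩ := exists_stable b₂ x
  let u := N + t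
  have hbc₂ : b₂ ≤ b₂ ⊔ Ideal.span {x ^ (2 * u)} := le_sup_left
  have hxc₂ : x ^ (2 * u) ∈ b₂ ⊔ Ideal.span {x ^ (2 * u)} :=
    Ideal.mem_sup_right (Ideal.mem_span_singleton_self _)
  have hcc : b₂ ⊔ Ideal.span {x ^ (2 * u)} ≤ b₁ ⊔ Ideal.span {x ^ t} := by
    refine sup_le (hs₂.trans le_sup_left) (le_sup_of_le_right ?_)
    rw [Ideal.span_singleton_le_span_singleton]
    exact pow_dvd_pow _ (by omega)
  obtain ⟨q, hq⟩ := exists_q (x ^ u) (x ^ (2 * u)) hbc₂ hxc₂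
    (fun r hr => hN u (by omega) _ r hr)
  have key : (SSmap hbc₁ hbc₂ hs₂ hcc).τ₁ =
      q ≫ ModuleCat.ofHom (LinearMap.lsmul R (R ⧸ b₂) (x ^ (u - t))) ≫
        pj hs₂ ≫ mm hbc₁ _ hxc₁ := by
    have : Epi (mm hbc₂ _ hxc₂) := (ModuleCat.epi_iff_surjective _).2 (mm_surj _ _ _)
    rw [← cancel_epi (mm hbc₂ _ hxc₂), reassoc_of% hq]
    ext1
    apply LinearMap.ext
    intro r
    obtain ⟨r, rfl⟩ := Submodule.mkQ_surjective _ r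
    apply Subtype.ext
    change (Submodule.Quotient.mk (x ^ (2 * u) * r) : R ⧸ b₁) =
      Submodule.Quotient.mk (x ^ t * (x ^ (u - t) * (x ^ u * r)))
    congr 1
    rw [← mul_assoc, ← mul_assoc, ← pow_add, ← pow_add]
    congr 2
    omega
  have hz : pb (SSmap hbc₁ hbc₂ hs₂ hcc).τ₁ e' = 0 := by
    have := congrArg (fun f => pb f e') key
    refine this.trans ?_
    dsimp only
    rw [pb_comp, pb_comp, pb_comp, he₂, pb_zero, pb_zero]
  have hfin : pb (pj (hcc.trans hca)) e = 0 := by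
    rw [← pj_comp hca hcc, pb_comp, ← he']
    have nat := ShortComplex.ShortExact.extClass_naturality (SS_exact hbc₂) (SS_exact hbc₁)
      (SSmap hbc₁ hbc₂ hs₂ hcc)
    change (Abelian.Ext.mk₀ (SSmap hbc₁ hbc₂ hs₂ hcc).τ₃).comp _ _ = 0
    rw [← Abelian.Ext.comp_assoc _ _ _ (zero_add 1) (by omega) (by omega), ← nat,
      Abelian.Ext.comp_assoc _ _ _ (add_zero 1) (zero_add _) (by omega)]
    refine (congrArg (fun z => (SS_exact hbc₂).extClass.comp z (by omega)) hz).trans ?_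
    simp
  refine ⟨2 * u + s₂, ?_, ?_⟩
  · refine le_trans ?_ (hcc.trans hca)
    refine Ideal.sup_pow_add_le_pow_sup_pow.trans ?_
    rw [Ideal.span_singleton_pow, sup_comm]
  · refine van_of (hcc.trans hca) hfin ?_
    refine Ideal.sup_pow_add_le_pow_sup_pow.trans ?_
    rw [Ideal.span_singleton_pow, sup_comm]

lemma van_list [IsNoetherianRing R] (D : ModuleCat.{u} R) (l : List R) :
    ∀ j, l.length < j → Van (Ideal.ofList l) j D := by
  induction l with
  | nil =>
    intro j hj
    rw [Ideal.ofList_nil]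
    exact van_nil j hj D
  | cons x l ih =>
    intro j hj
    obtain ⟨k, rfl⟩ : ∃ k, j = k + 2 := ⟨j - 2, by simp at hj; omega⟩
    simp at hj
    rw [Ideal.ofList_cons]
    exact van_cons _ _ _ _ (ih _ (by omega)) (ih _ (by omega))

lemma exists_bound [IsNoetherianRing R] (I : Ideal R) :
    ∃ r, ∀ j, r < j → ∀ D : ModuleCat.{u} R, Van I j D := by
  obtain ⟨s, hs⟩ := IsNoetherian.noetherian I
  refine ⟨s.toList.length, fun j hj D => ?_⟩
  have : I = Ideal.ofList s.toList := by
    rw [← hs, Ideal.ofList]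
    congr 1
    ext; simp
  rw [this]
  exact van_list D _ j hj

/-- universal classes -/
lemma exists_univ [IsNoetherianRing R] (j : ℕ) : ∀ (A : ModuleCat.{u} R) [Module.Finite R A],
    ∃ (D₀ : ModuleCat.{u} R) (_ : Module.Finite R D₀) (e₀ : Abelian.Ext A D₀ j),
      ∀ (D : ModuleCat.{u} R) (e : Abelian.Ext A D j), ∃ g : D₀ ⟶ D,
        e = e₀.comp (Abelian.Ext.mk₀ g) (add_zero j) := by
  induction j with
  | zero =>
    intro A hA
    refine ⟨A, hA, Abelian.Ext.mk₀ (𝟙 A), fun D e => ?_⟩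
    obtain ⟨g, rfl⟩ := Abelian.Ext.mk₀_bijective _ _ |>.2 e
    exact ⟨g, by simp⟩
  | succ j ih =>
    intro A hA
    obtain ⟨N, _, _, _, _, f, surjf⟩ := Module.exists_finite_presentation R A
    have exac := LinearMap.shortExact_shortComplexKer surjf
    obtain ⟨D₀, h₀, e₀, H⟩ := ih (ModuleCat.of R (LinearMap.ker f))
    refine ⟨D₀, h₀, exac.extClass.comp e₀ (by omega), fun D e => ?_⟩
    obtain ⟨e', he'⟩ := precomp_extClass_surjective_of_projective_X₂ D exac j e
    obtain ⟨g, rfl⟩ := H D e'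
    refine ⟨g, ?_⟩
    rw [← he']
    exact (Abelian.Ext.comp_assoc _ _ _ _ _ (by omega)).symm

def Kill (I : Ideal R) (j : ℕ) : Prop :=
  ∀ (a : Ideal R) (t : ℕ), I ^ t ≤ a → ∃ (s : ℕ) (h : I ^ s ≤ a),
    ∀ (D : ModuleCat.{u} R) (e : Abelian.Ext (ModuleCat.of R (R ⧸ a)) D j), pb (pj h) e = 0

lemma kill_of_van [IsNoetherianRing R] (I : Ideal R) (j : ℕ)
    (h : ∀ (D : ModuleCat.{u} R), Module.Finite R D → Van I j D) : Kill I j := by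
  intro a t ht
  obtain ⟨D₀, h₀, e₀, H⟩ := exists_univ j (ModuleCat.of R (R ⧸ a))
  obtain ⟨s, hs, hs'⟩ := h D₀ h₀ a t ht e₀
  refine ⟨s, hs, fun D e => ?_⟩
  obtain ⟨g, rfl⟩ := H D e
  rw [pb] at hs'
  rw [pb, ← Abelian.Ext.comp_assoc _ _ _ (zero_add j) _ (by omega), hs']
  simp

lemma van_pi (I : Ideal R) (j : ℕ) (h : Van I j (ModuleCat.of R R)) (m : ℕ) :
    Van I j (ModuleCat.of R (Fin m → R)) := by
  intro a t ht e
  let p (i : Fin m) : ModuleCat.of R (Fin m → R) ⟶ ModuleCat.of R R :=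
    ModuleCat.ofHom (LinearMap.proj i)
  let q (i : Fin m) : ModuleCat.of R R ⟶ ModuleCat.of R (Fin m → R) :=
    ModuleCat.ofHom (LinearMap.single R (fun _ => R) i)
  have hpq : 𝟙 _ = ∑ i, p i ≫ q i := by
    ext1
    rw [ModuleCat.hom_sum]
    apply LinearMap.ext
    intro v
    rw [LinearMap.sum_apply]
    exact (Finset.univ_sum_single v).symm
  choose s hs hs' using fun i => h a t ht (e.comp (Abelian.Ext.mk₀ (p i)) (add_zero j))
  let S := t + ∑ i, s i
  have hS : I ^ S ≤ a := (Ideal.pow_le_pow_right (by omega)).trans ht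
  refine ⟨S, hS, ?_⟩
  have hi (i : Fin m) : (pb (pj hS) e).comp (Abelian.Ext.mk₀ (p i)) (add_zero j) = 0 := by
    have h1 : I ^ S ≤ I ^ (s i) := Ideal.pow_le_pow_right (by
      have := Finset.single_le_sum (f := s) (fun _ _ => Nat.zero_le _) (Finset.mem_univ i)
      omega)
    have := van_of (hs i) (hs' i) h1
    rw [← this, pb, pb, Abelian.Ext.comp_assoc _ _ _ (zero_add j) (add_zero j) (by omega)]
  rw [← Abelian.Ext.comp_mk₀_id (pb (pj hS) e), hpq, Abelian.Ext.mk₀_sum, Abelian.Ext.comp_sum]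
  refine Finset.sum_eq_zero fun i _ => ?_
  rw [← Abelian.Ext.mk₀_comp_mk₀, ← Abelian.Ext.comp_assoc _ _ _ (add_zero j) _ (by omega), hi]
  simp

lemma kill_step [IsNoetherianRing R] (I : Ideal R) (j : ℕ) (h : Van I j (ModuleCat.of R R))
    (h' : Kill I (j + 1)) : Kill I j := by
  refine kill_of_van I j fun D hD a t ht e => ?_
  obtain ⟨m, f, hf⟩ := Module.Finite.exists_fin' R D
  have exac := LinearMap.shortExact_shortComplexKer hf
  obtain ⟨s, hs, H⟩ := h' a t ht
  have h1 := H _ (e.comp exac.extClass rfl)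
  obtain ⟨e', he'⟩ := Abelian.Ext.covariant_sequence_exact₃ _ exac (pb (pj hs) e) rfl (by
    rw [← h1, pb, pb, Abelian.Ext.comp_assoc _ _ _ (zero_add j) rfl (by omega)])
  obtain ⟨s', hs', H'⟩ := van_pi I j h m _ s le_rfl e'
  refine ⟨s', hs'.trans hs, ?_⟩
  rw [← pj_comp hs hs', pb_comp, ← he', pb,
    ← Abelian.Ext.comp_assoc _ _ _ (zero_add j) _ (by omega)]
  refine (congrArg (fun z => Abelian.Ext.comp z (Abelian.Ext.mk₀ _) (add_zero j)) H').trans ?_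
  simp

lemma kill_all [IsNoetherianRing R] (I : Ideal R) (n : ℕ)
    (h : ∀ j, n < j → Van I j (ModuleCat.of R R)) : ∀ j, n < j → Kill I j := by
  obtain ⟨r, hr⟩ := exists_bound I
  have : ∀ d j, n < j → r < j + d → Kill I j := by
    intro d
    induction d with
    | zero => exact fun j _ hj => kill_of_van I j fun D _ => hr j hj D
    | succ d ih => exact fun j hj hd => kill_step I j (h j hj) (ih _ (by omega) (by omega))
  exact fun j hj => this (r + 1) j hj (by omega)

end Cof
end

section
open Limits
namespace Cof
variable {R : Type u} [CommRing R]

section Elt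
variable {ι : Type} {c : ComplexShape ι} (K : HomologicalComplex (ModuleCat.{u} R) c)

lemma hom_surj (n : ι) (h : K.homology n) : ∃ z : K.cycles n, K.homologyπ n z = h :=
  (ModuleCat.epi_iff_surjective _).1 inferInstance h

lemma cyc_ex (i j : ι) (hj : c.next i = j) (x : K.X i) (hx : K.d i j x = 0) :
    ∃ z : K.cycles i, K.iCycles i z = x := by
  have h := ((ShortComplex.moduleCat_exact_iff _).1 ((ShortComplex.mk _ _ (K.iCycles_d i j)).exact_of_f_is_kernel
    (K.cyclesIsKernel i j hj))) x hx
  exact h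

lemma cyc_d (i j : ι) (z : K.cycles i) : K.d i j (K.iCycles i z) = 0 := by
  have := congr($(K.iCycles_d i j) z)
  exact this

lemma cyc_inj (i : ι) (z z' : K.cycles i) (h : K.iCycles i z = K.iCycles i z') : z = z' :=
  (ModuleCat.mono_iff_injective (K.iCycles i)).1 inferInstance h

lemma hom_zero_iff (i j : ι) (hi : c.prev j = i) (z : K.cycles j) :
    K.homologyπ j z = 0 ↔ ∃ y : K.X i, K.d i j y = K.iCycles j z := by
  constructor
  · intro h
    obtain ⟨y, hy⟩ := ((ShortComplex.moduleCat_exact_iff _).1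
      ((ShortComplex.mk _ _ (K.toCycles_comp_homologyπ i j)).exact_of_g_is_cokernel
        (K.homologyIsCokernel i j hi))) z h
    refine ⟨y, ?_⟩
    rw [← show K.toCycles i j y = z from hy]
    exact (congr($(K.toCycles_i i j) y)).symm
  · rintro ⟨y, hy⟩
    have : z = K.toCycles i j y := by
      apply cyc_inj
      rw [← hy]
      exact (congr($(K.toCycles_i i j) y)).symm
    rw [this]
    exact congr($(K.toCycles_comp_homologyπ i j) y)

variable {K}
variable {L : HomologicalComplex (ModuleCat.{u} R) c} (φ : K ⟶ L)

lemma hom_nat (i : ι) (z : K.cycles i) :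
    HomologicalComplex.homologyMap φ i (K.homologyπ i z) =
      L.homologyπ i (HomologicalComplex.cyclesMap φ i z) :=
  congr($(HomologicalComplex.homologyπ_naturality φ i) z)

lemma cyc_nat (i : ι) (z : K.cycles i) :
    L.iCycles i (HomologicalComplex.cyclesMap φ i z) = φ.f i (K.iCycles i z) :=
  congr($(HomologicalComplex.cyclesMap_i φ i) z)

lemma finite_hom_iff {A : Type*} [AddCommGroup A] [Module R A] (i j : ι) (hi : c.prev j = i)
    (Ψ : K.cycles j →ₗ[R] A) (hs : Function.Surjective Ψ)
    (hk : ∀ z, Ψ z = 0 ↔ ∃ y : K.X i, K.d i j y = K.iCycles j z) :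
    Module.Finite R (K.homology j) ↔ Module.Finite R A := by
  have h1 : LinearMap.ker Ψ = LinearMap.ker (K.homologyπ j).hom := by
    ext z
    rw [LinearMap.mem_ker, LinearMap.mem_ker, hk, ← hom_zero_iff K i j hi]
  have e1 := LinearMap.quotKerEquivOfSurjective Ψ hs
  have e2 := LinearMap.quotKerEquivOfSurjective (K.homologyπ j).hom (hom_surj K j)
  exact Module.Finite.equiv_iff (e2.symm.trans ((Submodule.quotEquivOfEq _ _ h1.symm).trans e1))

end Elt

section OldNew
variable {X : ModuleCat.{u} R} (P : ProjectiveResolution X) (Y : ModuleCat.{u} R)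

lemma extMk_zero_zero (f : P.complex.X 0 ⟶ Y) (hf : P.complex.d 1 0 ≫ f = 0) :
    P.extMk f 1 rfl hf = 0 ↔ f = 0 := by
  constructor
  · intro h
    simp only [← P.extEquivCohomologyClass.apply_eq_iff_eq,
      ProjectiveResolution.extEquivCohomologyClass_extMk, ProjectiveResolution.extEquivCohomologyClass_zero,
      CochainComplex.HomComplex.CohomologyClass.mk_eq_zero_iff] at h
    rw [CochainComplex.HomComplex.Cocycle.toSingleMk_mem_coboundaries_iff _ _ _ _ _ (1 : ℤ) (by simp)] at h
    obtain ⟨g, hg⟩ := h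
    have : IsZero (P.cochainComplex.X 1) :=
      P.cochainComplex.isZero_of_isStrictlyLE 0 1 (by simp)
    have h0 : (P.cochainComplexXIso (-(0:ℕ)) 0 rfl).hom ≫ f = 0 := by
      rw [← hg, this.eq_of_src g 0, comp_zero]
    simpa using h0
  · rintro rfl
    simp

def iC (n : ℕ) (z : (P.complex.linearYonedaObj R Y).cycles n) : P.complex.X n ⟶ Y :=
  (P.complex.linearYonedaObj R Y).iCycles n z

lemma iC_d (n : ℕ) (z) : P.complex.d (n+1) n ≫ iC P Y n z = 0 :=
  cyc_d (P.complex.linearYonedaObj R Y) n (n+1) z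

lemma iC_add (n : ℕ) (z z') : iC P Y n (z + z') = iC P Y n z + iC P Y n z' :=
  map_add ((P.complex.linearYonedaObj R Y).iCycles n).hom z z'

lemma iC_smul (n : ℕ) (r : R) (z) : iC P Y n (r • z) = r • iC P Y n z :=
  map_smul ((P.complex.linearYonedaObj R Y).iCycles n).hom r z

def extPsi (n : ℕ) : (P.complex.linearYonedaObj R Y).cycles n →ₗ[R] Abelian.Ext X Y n where
  toFun z := P.extMk (iC P Y n z) (n+1) rfl (iC_d P Y n z)
  map_add' z z' := by
    rw [P.add_extMk]
    congr 1
    exact iC_add P Y n z z'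
  map_smul' r z := by
    rw [Abelian.Ext.smul_eq_comp_mk₀, RingHom.id_apply, P.extMk_comp_mk₀]
    congr 1
    rw [iC_smul]
    simp

lemma extPsi_apply (n : ℕ) (z) :
    extPsi P Y n z = P.extMk (iC P Y n z) (n+1) rfl (iC_d P Y n z) := rfl

lemma extPsi_surj (n : ℕ) : Function.Surjective (extPsi P Y n) := by
  intro e
  obtain ⟨f, hf, rfl⟩ := P.extMk_surjective e (n+1) rfl
  obtain ⟨z, hz⟩ := cyc_ex (P.complex.linearYonedaObj R Y) n (n+1) (by simp) f hf
  refine ⟨z, ?_⟩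
  rw [extPsi_apply]
  congr 1

lemma extPsi_zero (n : ℕ) (z) : extPsi P Y n z = 0 ↔
    (P.complex.linearYonedaObj R Y).homologyπ n z = 0 := by
  rw [extPsi_apply]
  cases n with
  | zero =>
    rw [extMk_zero_zero, hom_zero_iff _ 0 0 (by simp)]
    constructor
    · intro h
      exact ⟨0, by rw [map_zero]; exact h.symm⟩
    · rintro ⟨y, hy⟩
      refine hy.symm.trans ?_
      rw [HomologicalComplex.shape _ _ _ (by simp)]; rfl
  | succ n =>
    rw [P.extMk_eq_zero_iff _ _ _ _ n rfl, hom_zero_iff _ n (n+1) (by simp)]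
    rfl

lemma finite_ext_iff (n : ℕ) (X Y : ModuleCat.{u} R) :
    Module.Finite R (((Ext R (ModuleCat.{u} R) n).obj (Opposite.op X)).obj Y) ↔
      Module.Finite R (Abelian.Ext X Y n) := by
  let P := projectiveResolution X
  rw [Module.Finite.equiv_iff (P.isoExt n Y).toLinearEquiv]
  refine finite_hom_iff _ n rfl (extPsi P Y n) (extPsi_surj P Y n) fun z => ?_
  rw [extPsi_zero, hom_zero_iff _ _ _ rfl]


def lyMap {X' : ModuleCat.{u} R} {P : ProjectiveResolution X} {P' : ProjectiveResolution X'}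
    (φ : P'.complex ⟶ P.complex) :
    P.complex.linearYonedaObj R Y ⟶ P'.complex.linearYonedaObj R Y :=
  (HomologicalComplex.unopFunctor _ _).map
    ((((linearYoneda R (ModuleCat.{u} R)).obj Y).rightOp.mapHomologicalComplex _).map φ).op

lemma sq_inv {C : Type*} [Category* C] {A A' B B' : C} {f : A ⟶ B} {e : B ≅ B'} {e' : A ≅ A'}
    {g : A' ⟶ B'} (h : f ≫ e.hom = e'.hom ≫ g) : e'.inv ≫ f = g ≫ e.inv := by
  rw [Iso.inv_comp_eq, ← Category.assoc, Iso.eq_comp_inv, h]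

lemma isoExt_nat {X' : ModuleCat.{u} R} (f : X' ⟶ X) {P : ProjectiveResolution X}
    {P' : ProjectiveResolution X'}
    (φ : P'.complex ⟶ P.complex) (comm : φ.f 0 ≫ P.π.f 0 = P'.π.f 0 ≫ f) (n : ℕ) :
    ((Ext R (ModuleCat.{u} R) n).map f.op).app Y ≫ (P'.isoExt n Y).hom =
      (P.isoExt n Y).hom ≫ HomologicalComplex.homologyMap (lyMap Y φ) n := by
  have h := congr($(ProjectiveResolution.isoLeftDerivedObj_inv_naturality f P' P φ comm
    ((linearYoneda R (ModuleCat.{u} R)).obj Y).rightOp n).unop)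
  have h2 := HomologicalComplex.homologyOp_hom_naturality (lyMap Y φ) n
  have h3 := sq_inv h2
  have h4 := congr($(h3).unop)
  refine Eq.trans (Category.assoc _ _ _).symm ?_
  refine Eq.trans (congr($h ≫ (HomologicalComplex.homologyUnop _ n).inv)) ?_
  refine Eq.trans (Category.assoc _ _ _) ?_
  refine Eq.trans ?_ (Category.assoc _ _ _).symm
  exact congr((P.isoLeftDerivedObj ((linearYoneda R (ModuleCat.{u} R)).obj Y).rightOp n).inv.unop ≫ $h4)

end OldNew
end Cof
end

section
open Limits
namespace Cof
variable {R : Type u} [CommRing R]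

lemma pb_eq_zero_of_old {X X' Y : ModuleCat.{u} R} (f : X' ⟶ X) (n : ℕ) (P : ProjectiveResolution X)
    (P' : ProjectiveResolution X')
    (z : (P.complex.linearYonedaObj R Y).cycles n)
    (h : ((Ext R (ModuleCat.{u} R) n).map f.op).app Y
      ((P.isoExt n Y).inv
        ((P.complex.linearYonedaObj R Y).homologyπ n z)) = 0) :
    pb f (extPsi P Y n z) = 0 := by
  let φ : ProjectiveResolution.Hom P' P f :=
    { hom := ProjectiveResolution.lift f P' P
      hom_f_zero_comp_π_f_zero := ProjectiveResolution.lift_commutes_zero f P' P }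
  have h1 := congr($(isoExt_nat Y f φ.hom (ProjectiveResolution.lift_commutes_zero f P' P) n)
    ((P.isoExt n Y).inv ((P.complex.linearYonedaObj R Y).homologyπ n z)))
  have h2 : (P'.isoExt n Y).hom (((Ext R (ModuleCat.{u} R) n).map f.op).app Y
    ((P.isoExt n Y).inv ((P.complex.linearYonedaObj R Y).homologyπ n z))) =
    HomologicalComplex.homologyMap (lyMap Y φ.hom) n
      ((P.isoExt n Y).hom ((P.isoExt n Y).inv ((P.complex.linearYonedaObj R Y).homologyπ n z))) := h1
  rw [h, map_zero, Iso.inv_hom_id_apply] at h2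
  have h3 := (hom_nat (lyMap Y φ.hom) n z).symm.trans h2.symm
  rw [← extPsi_zero, extPsi_apply] at h3
  rw [pb, extPsi_apply, ProjectiveResolution.mk₀_comp_extMk _ _ _ _ φ]
  rw [← h3]
  congr 1
  exact (cyc_nat (lyMap Y φ.hom) n z).symm

lemma van_of_lc (I : Ideal R) (j : ℕ) (D : ModuleCat.{u} R)
    (h : Subsingleton ((localCohomology I j).obj D)) : Van I j D := by
  intro a t hat e
  obtain ⟨z, hz⟩ := extPsi_surj (projectiveResolution (ModuleCat.of R (R ⧸ I ^ t))) D j (pb (pj hat) e)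
  set x := ((projectiveResolution (ModuleCat.of R (R ⧸ I ^ t))).isoExt j D).inv
        (((projectiveResolution (ModuleCat.of R (R ⧸ I ^ t))).complex.linearYonedaObj R D).homologyπ j z)
    with hx
  let F := localCohomology.diagram (localCohomology.idealPowersDiagram I) j
  have hc := isColimitOfPreserves ((evaluation _ _).obj D) (colimit.isColimit F)
  have h0 : ∀ (i : (ℕᵒᵖ)ᵒᵖ) (w w' : (F.obj i).obj D), ((colimit.ι F i).app D) w =
    ((colimit.ι F i).app D) w' := fun i w w' => h.elim _ _
  have : PreservesFilteredColimitsOfSize.{0, 0} (forget (ModuleCat.{u} R)) :=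
    preservesFilteredColimitsOfSize_shrink.{0, u, 0, u} _
  obtain ⟨k, f, hk⟩ := (IsColimit.eq_iff' hc (i := Opposite.op (Opposite.op t)) x 0).1 (h0 _ _ _)
  rw [map_zero] at hk
  have hts : t ≤ k.unop.unop := f.unop.unop.down.down
  refine ⟨k.unop.unop, (Ideal.pow_le_pow_right hts).trans hat, ?_⟩
  rw [← pj_comp hat (Ideal.pow_le_pow_right hts), pb_comp, ← hz]
  exact pb_eq_zero_of_old _ _ _ (projectiveResolution _) _ hk

end Cof
end

section
open Limits
namespace Cof
variable {R : Type u} [CommRing R]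

/-- predicates behaving like finiteness of the members of a homological functor -/
structure FinSys (P : ℤ → ModuleCat.{u} R → Prop) : Prop where
  zero : ∀ i N, IsZero N → P i N
  ext : ∀ i (S : ShortComplex (ModuleCat.{u} R)), S.ShortExact → P i S.X₁ → P i S.X₃ → P i S.X₂
  quot : ∀ i (S : ShortComplex (ModuleCat.{u} R)), S.ShortExact →
    P i S.X₂ → P (i+1) S.X₁ → P i S.X₃
  bdd : ∃ B : ℤ, ∀ i, B < i → ∀ N, P i N

def FinKill (P : ℤ → ModuleCat.{u} R → Prop) (y : R) : Prop :=
  ∀ (i : ℤ) (K N L C : ModuleCat.{u} R) (k : K ⟶ N) (p : N ⟶ L) (q : L ⟶ N) (c : N ⟶ C)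
    (w : k ≫ p = 0) (w' : q ≫ c = 0), (ShortComplex.mk k p w).ShortExact →
    (ShortComplex.mk q c w').ShortExact → p ≫ q = y • 𝟙 N → P (i+1) K → P i C → P i N

variable {P : ℤ → ModuleCat.{u} R → Prop}

lemma FinSys.iso (hP : FinSys P) (i : ℤ) {N N' : ModuleCat.{u} R} (e : N ≅ N') (h : P i N') :
    P i N := by
  have hS : (ShortComplex.mk (0 : ModuleCat.of R PUnit ⟶ N) e.hom zero_comp).ShortExact := by
    refine ModuleCat.shortComplex_shortExact _ ?_ ?_ ?_
    · intro x
      constructor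
      · intro hx
        exact ⟨0, by
          have := (ConcreteCategory.bijective_of_isIso e.hom).1 (a₁ := x) (a₂ := 0) (by rw [map_zero]; exact hx)
          rw [this, map_zero]⟩
      · rintro ⟨x, rfl⟩
        exact map_zero _
    · intro x y _
      rfl
    · exact (ConcreteCategory.bijective_of_isIso e.hom).2
  exact hP.ext i _ hS (hP.zero _ _ (ModuleCat.isZero_of_subsingleton _)) h

lemma desc_ind {B : ℤ} {Q : ℤ → Prop} {b : ℤ} (h0 : ∀ i, B < i → Q i)
    (h : ∀ i, b ≤ i → Q (i+1) → Q i) (i : ℤ) (hi : b ≤ i) : Q i := by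
  obtain ⟨m, hm⟩ : ∃ m : ℕ, B < i + m := ⟨(B - i + 1).toNat, by omega⟩
  induction m generalizing i with
  | zero => exact h0 _ (by simpa using hm)
  | succ m ih => exact h i hi (ih (i+1) (by omega) (by push_cast at hm; omega))

lemma FinSys.fg [IsNoetherianRing R] (hP : FinSys P) (I : Ideal R) (b : ℤ)
    (h : ∀ i, b ≤ i → P i (ModuleCat.of R (R ⧸ I))) (i : ℤ) (hi : b ≤ i) :
    ∀ (N : Type u) [AddCommGroup N] [Module R N] (_ : Module.Finite R N) (k : ℕ)
      (_ : ∀ r ∈ I ^ k, ∀ x : N, r • x = 0), P i (ModuleCat.of R N) := by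
  obtain ⟨B, hB⟩ := hP.bdd
  refine desc_ind (B := B) (Q := fun i => ∀ (N : Type u) [AddCommGroup N] [Module R N]
    (_ : Module.Finite R N) (k : ℕ)
      (_ : ∀ r ∈ I ^ k, ∀ x : N, r • x = 0), P i (ModuleCat.of R N)) ?_ ?_ i hi
  · intro i hi N _ _ _ _ _
    exact hB i hi _
  · clear i hi
    intro i hi ih N _ _ hN k
    induction hN using
      IsNoetherianRing.induction_on_isQuotientEquivQuotientPrime R with
    | subsingleton N =>
      intro _
      exact hP.zero _ _ (ModuleCat.isZero_of_subsingleton _)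
    | quotient N p f =>
      intro hk
      have h1 : I ≤ p.1 := by
        refine p.2.le_of_pow_le (n := k) fun r hr => ?_
        have := congr(f $(hk r hr (f.symm (Submodule.Quotient.mk 1))))
        rw [map_smul, f.apply_symm_apply, map_zero, ← Submodule.Quotient.mk_smul,
          Submodule.Quotient.mk_eq_zero] at this
        simpa using this
      refine hP.iso i f.toModuleIso (hP.quot i _ (SS_exact h1) (h i hi) ?_)
      refine ih _ inferInstance 1 ?_
      rintro r hr ⟨x, hx⟩
      rw [pow_one] at hr
      obtain ⟨x, rfl⟩ := Submodule.mkQ_surjective _ x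
      refine Subtype.ext ?_
      change r • Submodule.mkQ I x = 0
      rw [← map_smul, Submodule.mkQ_apply, Submodule.Quotient.mk_eq_zero]
      exact I.mul_mem_right _ hr
    | exact N₁ N₂ N₃ f g hf hg hfg h₁ h₃ =>
      intro hk
      have hS : (ShortComplex.mk (ModuleCat.ofHom f) (ModuleCat.ofHom g)
        (by ext x; exact hfg.apply_apply_eq_zero x)).ShortExact :=
        ModuleCat.shortComplex_shortExact _ hfg hf hg
      refine hP.ext i _ hS (h₁ ?_) (h₃ ?_)
      · intro r hr x
        apply hf
        rw [map_smul, hk r hr, map_zero]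
      · intro r hr x
        obtain ⟨x, rfl⟩ := hg x
        rw [← map_smul, hk r hr, map_zero]

lemma FinSys.of_self [IsNoetherianRing R] (hP : FinSys P)
    (h : ∀ i, P i (ModuleCat.of R R)) (i : ℤ)
    (N : Type u) [AddCommGroup N] [Module R N] [Module.Finite R N] : P i (ModuleCat.of R N) := by
  refine hP.fg ⊥ i (fun i _ => hP.iso i ?_ (h i)) i le_rfl N inferInstance 1 ?_
  · exact (Submodule.quotEquivOfEqBot (⊥ : Ideal R) rfl).toModuleIso
  · intro r hr x
    rw [pow_one, Ideal.mem_bot] at hr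
    simp [hr]

lemma FinSys.remove [IsNoetherianRing R] (i : ℤ)
    (ih : ∀ (N : Type u) [AddCommGroup N] [Module R N] [Module.Finite R N],
      P (i+1) (ModuleCat.of R N)) (l : List R) (hl : ∀ y ∈ l, FinKill P y) :
    (∀ (N : Type u) [AddCommGroup N] [Module R N] [Module.Finite R N],
      (∀ y ∈ l, ∀ x : N, y • x = 0) → P i (ModuleCat.of R N)) →
    ∀ (N : Type u) [AddCommGroup N] [Module R N] [Module.Finite R N], P i (ModuleCat.of R N) := by
  induction l with
  | nil =>
    intro h N _ _ _
    exact h N (by simp)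
  | cons y l IH =>
    intro h
    refine IH (fun y hy => hl y (List.mem_cons_of_mem _ hy)) ?_
    intro N _ _ _ hN
    let f : N →ₗ[R] N := LinearMap.lsmul R N y
    refine hl y List.mem_cons_self i (ModuleCat.of R (LinearMap.ker f)) (ModuleCat.of R N)
      (ModuleCat.of R (LinearMap.range f)) (ModuleCat.of R (N ⧸ LinearMap.range f))
      (ModuleCat.ofHom (LinearMap.ker f).subtype) (ModuleCat.ofHom f.rangeRestrict)
      (ModuleCat.ofHom (LinearMap.range f).subtype) (ModuleCat.ofHom (LinearMap.range f).mkQ)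
      ?_ ?_ ?_ ?_ ?_ (ih _) (h _ ?_)
    · ext x
      exact x.2
    · ext x
      exact (Submodule.Quotient.mk_eq_zero _).2 x.2
    · refine ModuleCat.shortComplex_shortExact _ ?_ ?_ ?_
      · intro x
        constructor
        · intro hx
          exact ⟨⟨x, congr_arg Subtype.val hx⟩, rfl⟩
        · rintro ⟨x, rfl⟩
          exact Subtype.ext x.2
      · exact Subtype.val_injective
      · exact f.surjective_rangeRestrict
    · refine ModuleCat.shortComplex_shortExact _ ?_ ?_ ?_
      · intro x
        constructor
        · intro hx
          exact ⟨⟨x, (Submodule.Quotient.mk_eq_zero _).1 hx⟩, rfl⟩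
        · rintro ⟨x, rfl⟩
          exact (Submodule.Quotient.mk_eq_zero _).2 x.2
      · exact Subtype.val_injective
      · exact Submodule.mkQ_surjective _
    · ext x
      rfl
    · intro z hz x
      obtain ⟨x, rfl⟩ := Submodule.mkQ_surjective _ x
      rw [← map_smul]
      rcases List.mem_cons.1 hz with rfl | hz
      · exact (Submodule.Quotient.mk_eq_zero _).2 ⟨x, rfl⟩
      · rw [hN z hz, map_zero]

lemma FinSys.to_self [IsNoetherianRing R] (hP : FinSys P) (I : Ideal R) (l : List R)
    (hl : ∀ y ∈ l, FinKill P y) (k : ℕ) (hk : I ^ k ≤ Ideal.span {y | y ∈ l})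
    (h : ∀ i, P i (ModuleCat.of R (R ⧸ I))) (i : ℤ) : P i (ModuleCat.of R R) := by
  obtain ⟨B, hB⟩ := hP.bdd
  have := desc_ind (B := B) (Q := fun i => ∀ (N : Type u) [AddCommGroup N] [Module R N]
    [Module.Finite R N], P i (ModuleCat.of R N)) (b := i) ?_ ?_ i le_rfl
  · exact this R
  · intro i hi N _ _ _
    exact hB i hi _
  · intro j _ ih
    refine FinSys.remove j ih l hl ?_
    intro N _ _ _ hN
    refine hP.fg I j (fun i _ => h i) j le_rfl N inferInstance k ?_
    intro r hr x
    have : Ideal.span {y | y ∈ l} ≤ Module.annihilator R N :=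
      Ideal.span_le.2 fun y hy => Module.mem_annihilator.2 (hN y hy)
    exact Module.mem_annihilator.1 (this (hk hr)) x

end Cof
end

section
open Limits
namespace Cof
variable {R : Type u} [CommRing R]

lemma fin_mid [IsNoetherianRing R] {A B C : Type*} [AddCommGroup A] [Module R A] [AddCommGroup B]
    [Module R B] [AddCommGroup C] [Module R C] (f : A →ₗ[R] B) (g : B →ₗ[R] C)
    (h : ∀ b, g b = 0 → ∃ a, f a = b) (hA : Module.Finite R A) (hC : Module.Finite R C) :
    Module.Finite R B := by
  refine ⟨Submodule.fg_of_fg_map_of_fg_inf_ker g ?_ ?_⟩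
  · exact IsNoetherian.noetherian _
  · have h1 : (LinearMap.range f).FG := by
      rw [LinearMap.range_eq_map]; exact hA.1.map f
    have : Module.Finite R (LinearMap.range f) := Module.Finite.iff_fg.2 h1
    have : IsNoetherian R (LinearMap.range f) := inferInstance
    refine Submodule.FG.of_le h1 ?_
    intro b hb
    exact h b hb.2

/-- the kill situation -/
lemma fin_kill [IsNoetherianRing R] {K L N C : Type*} [AddCommGroup K] [Module R K]
    [AddCommGroup L] [Module R L] [AddCommGroup N] [Module R N]
    [AddCommGroup C] [Module R C]
    (c : C →ₗ[R] N) (q : N →ₗ[R] L) (p : L →ₗ[R] N) (k : K →ₗ[R] L)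
    (h1 : ∀ b, q b = 0 → ∃ a, c a = b) (h2 : ∀ b, p b = 0 → ∃ a, k a = b)
    (h : ∀ b, p (q b) = 0) (hC : Module.Finite R C) (hK : Module.Finite R K) :
    Module.Finite R N := by
  have hr : (LinearMap.range k).FG := by
    rw [LinearMap.range_eq_map]; exact hK.1.map k
  refine fin_mid c (q.codRestrict (LinearMap.range k) (fun b => h2 _ (h b))) ?_ hC
    (Module.Finite.iff_fg.2 hr)
  intro b hb
  exact h1 b (congr_arg Subtype.val hb)

/-- dual kill situation -/
lemma fin_kill' [IsNoetherianRing R] {K L N C : Type*} [AddCommGroup K] [Module R K]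
    [AddCommGroup L] [Module R L] [AddCommGroup N] [Module R N]
    [AddCommGroup C] [Module R C]
    (p : N →ₗ[R] L) (q : L →ₗ[R] N) (c : N →ₗ[R] C) (k : L →ₗ[R] K)
    (h1 : ∀ b, c b = 0 → ∃ a, q a = b) (h2 : ∀ b, k b = 0 → ∃ a, p a = b)
    (h : ∀ b, q (p b) = 0) (hC : Module.Finite R C) (hK : Module.Finite R K) :
    Module.Finite R N := by
  have hk : Module.Finite R (L ⧸ LinearMap.ker k) :=
    Module.Finite.equiv k.quotKerEquivRange.symm
  have hq : LinearMap.ker k ≤ LinearMap.ker q := by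
    intro b hb
    obtain ⟨a, rfl⟩ := h2 b hb
    exact h a
  refine fin_mid ((LinearMap.ker k).liftQ q hq) c ?_ hk hC
  intro b hb
  obtain ⟨a, rfl⟩ := h1 b hb
  exact ⟨Submodule.Quotient.mk a, rfl⟩

abbrev Cx (R : Type u) [CommRing R] := CochainComplex (ModuleCat.{u} R) ℤ

section
variable {S : ShortComplex (Cx R)} (hS : S.ShortExact)
include hS

lemma les₂ (i : ℤ) (b : S.X₂.homology i) (hb : HomologicalComplex.homologyMap S.g i b = 0) :
    ∃ a, HomologicalComplex.homologyMap S.f i a = b :=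
  (ShortComplex.moduleCat_exact_iff _).1 (hS.homology_exact₂ i) b hb

lemma les₃ (i j : ℤ) (hij : i + 1 = j) (b : S.X₃.homology i) (hb : hS.δ i j hij b = 0) :
    ∃ a, HomologicalComplex.homologyMap S.g i a = b :=
  (ShortComplex.moduleCat_exact_iff _).1 (hS.homology_exact₃ i j hij) b hb

lemma les₁ (i j : ℤ) (hij : i + 1 = j) (b : S.X₁.homology j)
    (hb : HomologicalComplex.homologyMap S.f j b = 0) :
    ∃ a, hS.δ i j hij a = b :=
  (ShortComplex.moduleCat_exact_iff _).1 (hS.homology_exact₁ i j hij) b hb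

lemma lesf₂ [IsNoetherianRing R] (i : ℤ) (h1 : Module.Finite R (S.X₁.homology i))
    (h3 : Module.Finite R (S.X₃.homology i)) : Module.Finite R (S.X₂.homology i) :=
  fin_mid (HomologicalComplex.homologyMap S.f i).hom (HomologicalComplex.homologyMap S.g i).hom
    (les₂ hS i) h1 h3

lemma lesf₃ [IsNoetherianRing R] (i j : ℤ) (hij : i + 1 = j)
    (h2 : Module.Finite R (S.X₂.homology i))
    (h1 : Module.Finite R (S.X₁.homology j)) : Module.Finite R (S.X₃.homology i) :=
  fin_mid (HomologicalComplex.homologyMap S.g i).hom (hS.δ i j hij).hom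
    (les₃ hS i j hij) h2 h1

lemma lesf₁ [IsNoetherianRing R] (i j : ℤ) (hij : i + 1 = j)
    (h2 : Module.Finite R (S.X₂.homology j))
    (h3 : Module.Finite R (S.X₃.homology i)) : Module.Finite R (S.X₁.homology j) :=
  fin_mid (hS.δ i j hij).hom (HomologicalComplex.homologyMap S.f j).hom
    (les₁ hS i j hij) h3 h2
end

lemma homologyMap_smul' {X Y : Cx R} (φ : X ⟶ Y) (r : R) (i : ℤ) :
    HomologicalComplex.homologyMap (r • φ) i = r • HomologicalComplex.homologyMap φ i :=
  ShortComplex.homologyMap_smul (S₁ := X.sc i) (S₂ := Y.sc i)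
    ((HomologicalComplex.shortComplexFunctor _ _ i).map φ) r

/-- short exactness of complexes, termwise -/
lemma ses_cx (S : ShortComplex (Cx R))
    (h : ∀ i, (S.map (HomologicalComplex.eval _ _ i)).ShortExact) : S.ShortExact :=
  HomologicalComplex.shortExact_of_degreewise_shortExact _ h

lemma fin_of_zero {X : Cx R} (i : ℤ) (h : IsZero (X.X i)) : Module.Finite R (X.homology i) := by
  have h1 : Subsingleton (X.X i) := ModuleCat.isZero_iff_subsingleton.1 h
  have h2 : Subsingleton (X.homology i) := by
    refine ⟨fun a b => ?_⟩
    obtain ⟨a, rfl⟩ := hom_surj X i a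
    obtain ⟨b, rfl⟩ := hom_surj X i b
    rw [cyc_inj X i a b (Subsingleton.elim _ _)]
  infer_instance

end Cof
end

section
open Limits
namespace Cof
variable {R : Type u} [CommRing R]

abbrev Kz (Y : Cx R) (x : R) : Cx R := CochainComplex.mappingCone (x • 𝟙 Y)

abbrev HF (R : Type u) [CommRing R] := HomotopyCategory.homologyFunctor (ModuleCat.{u} R) (ComplexShape.up ℤ) 0

abbrev qt (R : Type u) [CommRing R] := HomotopyCategory.quotient (ModuleCat.{u} R) (ComplexShape.up ℤ)

def eH (Y : Cx R) (n : ℤ) : ((HF R).shift n).obj ((qt R).obj Y) ≅ Y.homology n :=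
  (HomotopyCategory.homologyFunctorFactors (ModuleCat.{u} R) (ComplexShape.up ℤ) n).app Y

lemma eH_smul (Y : Cx R) (n : ℤ) (x : R) :
    ((HF R).shift n).map ((qt R).map (x • 𝟙 Y)) = x • 𝟙 _ := by
  have h := (HomotopyCategory.homologyFunctorFactors (ModuleCat.{u} R) (ComplexShape.up ℤ) n).hom.naturality (x • 𝟙 Y)
  have h' : ((HF R).shift n).map ((qt R).map (x • 𝟙 Y)) ≫ (eH Y n).hom =
    (eH Y n).hom ≫ HomologicalComplex.homologyMap (x • 𝟙 Y) n := h
  rw [homologyMap_smul', HomologicalComplex.homologyMap_id] at h'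
  rw [← cancel_mono (eH Y n).hom, h', Linear.comp_smul, Category.comp_id, Linear.smul_comp,
    Category.id_comp]

structure ConeLES (Y : Cx R) (x : R) (i j : ℤ) where
  ι : Y.homology i →ₗ[R] (Kz Y x).homology i
  ρ : (Kz Y x).homology i →ₗ[R] Y.homology j
  h1 : ∀ a, ι a = 0 → ∃ b, x • b = a
  h1' : ∀ b, ι (x • b) = 0
  h2 : ∀ c, ρ c = 0 → ∃ a, ι a = c
  h3 : ∀ c, x • ρ c = 0

def coneLES (Y : Cx R) (x : R) (i j : ℤ) (hij : i + 1 = j) : ConeLES Y x i j := by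
  have hT := HomotopyCategory.mappingCone_triangleh_distinguished (x • 𝟙 Y)
  have E1 := (ShortComplex.moduleCat_exact_iff _).1 ((HF R).homologySequence_exact₂ _ hT i)
  have E2 := (ShortComplex.moduleCat_exact_iff _).1 ((HF R).homologySequence_exact₃ _ hT i j hij)
  have c1 := (HF R).homologySequence_comp _ hT i
  have c2 := (HF R).homologySequenceδ_comp _ hT i j hij
  let m2 : ((HF R).shift i).obj ((qt R).obj Y) ⟶ ((HF R).shift i).obj ((qt R).obj (Kz Y x)) :=
    ((HF R).shift i).map (CochainComplex.mappingCone.triangleh (x • 𝟙 Y)).mor₂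
  let d : ((HF R).shift i).obj ((qt R).obj (Kz Y x)) ⟶ ((HF R).shift j).obj ((qt R).obj Y) :=
    (HF R).homologySequenceδ (CochainComplex.mappingCone.triangleh (x • 𝟙 Y)) i j hij
  have E2' : ∀ c, d c = 0 → ∃ a, m2 a = c := fun c => E2 c
  have E1' : ∀ a, m2 a = 0 → ∃ b, x • b = a := fun a ha => by
    obtain ⟨b, hb⟩ := E1 a ha
    refine ⟨b, ?_⟩
    rw [← hb]
    exact (congr($(eH_smul Y i x) b)).symm
  have c1' : ∀ b, m2 (x • b) = 0 := fun b => by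
    have h := congr($c1 b)
    refine Eq.trans ?_ h
    exact congr_arg m2 (congr($(eH_smul Y i x) b)).symm
  have c2' : ∀ c, x • d c = 0 := fun c => by
    have h := congr($c2 c)
    refine Eq.trans ?_ h
    exact (congr($(eH_smul Y j x) (d c))).symm
  let ey := (eH Y i).toLinearEquiv
  let ey' := (eH Y j).toLinearEquiv
  let ek := (eH (Kz Y x) i).toLinearEquiv
  exact
  { ι := ek.toLinearMap ∘ₗ m2.hom ∘ₗ ey.symm.toLinearMap
    ρ := ey'.toLinearMap ∘ₗ d.hom ∘ₗ ek.symm.toLinearMap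
    h1 := fun a ha => by
      obtain ⟨b, hb⟩ := E1' (ey.symm a) (ek.injective (ha.trans (map_zero ek).symm))
      exact ⟨ey b, by rw [← map_smul, hb, LinearEquiv.apply_symm_apply]⟩
    h1' := fun b => by
      change ek (m2 (ey.symm (x • b))) = 0
      rw [map_smul, c1', map_zero]
    h2 := fun c hc => by
      obtain ⟨a, ha⟩ := E2' (ek.symm c) (ey'.injective (hc.trans (map_zero ey').symm))
      refine ⟨ey a, ?_⟩
      change ek (m2 (ey.symm (ey a))) = c
      rw [LinearEquiv.symm_apply_apply, ha, LinearEquiv.apply_symm_apply]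
    h3 := fun c => by
      change x • ey' (d (ek.symm c)) = 0
      rw [← map_smul, c2', map_zero] }

/-- `y` kills all homology -/
def HK (Y : Cx R) (y : R) : Prop := ∀ i (h : Y.homology i), y • h = 0

def HFin (Y : Cx R) : Prop := ∀ i, Module.Finite R (Y.homology i)

lemma cone_fin [IsNoetherianRing R] (Y : Cx R) (x : R) (hx : HK Y x) : HFin (Kz Y x) ↔ HFin Y := by
  constructor
  · intro h i
    have e := coneLES Y x i (i+1) rfl
    have := h i
    refine Module.Finite.of_injective e.ι ?_
    rw [← LinearMap.ker_eq_bot, LinearMap.ker_eq_bot']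
    intro a ha
    obtain ⟨b, rfl⟩ := e.h1 a ha
    exact hx i b
  · intro h i
    have e := coneLES Y x i (i+1) rfl
    exact fin_mid e.ι e.ρ e.h2 (h i) (h (i+1))

lemma cone_kill_self (Y : Cx R) (x : R) : HK (Kz Y x) (x ^ 2) := by
  intro i c
  have e := coneLES Y x i (i+1) rfl
  obtain ⟨a, ha⟩ := e.h2 (x • c) (by rw [map_smul, e.h3])
  rw [pow_two, mul_smul, ← ha, ← map_smul, e.h1']

lemma cone_kill (Y : Cx R) (x y : R) (hy : HK Y y) : HK (Kz Y x) (y ^ 2) := by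
  intro i c
  have e := coneLES Y x i (i+1) rfl
  obtain ⟨a, ha⟩ := e.h2 (y • c) (by rw [map_smul, hy])
  rw [pow_two, mul_smul, ← ha, ← map_smul, hy, map_zero]

lemma HK_dvd (Y : Cx R) {y z : R} (h : HK Y y) (hd : y ∣ z) : HK Y z := by
  obtain ⟨w, rfl⟩ := hd
  intro i a
  rw [mul_comm, mul_smul, h, smul_zero]

lemma HFin_iso {Y Z : Cx R} (e : Y ≅ Z) : HFin Y ↔ HFin Z :=
  forall_congr' fun i => Module.Finite.equiv_iff
    ((HomologicalComplex.homologyFunctor _ _ i).mapIso e).toLinearEquiv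

lemma HK_iso {Y Z : Cx R} (e : Y ≅ Z) (y : R) (h : HK Y y) : HK Z y := by
  intro i z
  let l : Y.homology i ≃ₗ[R] Z.homology i :=
    ((HomologicalComplex.homologyFunctor _ _ i).mapIso e).toLinearEquiv
  apply l.symm.injective
  rw [map_smul, h, map_zero]

section F
variable (F : ModuleCat.{u} R ⥤ ModuleCat.{u} R) [F.Additive] [F.Linear R]

abbrev Fc (X : Cx R) : Cx R := (F.mapHomologicalComplex (ComplexShape.up ℤ)).obj X

def FcK (X : Cx R) (x : R) : Fc F (Kz X x) ≅ Kz (Fc F X) x :=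
  CochainComplex.mappingCone.mapHomologicalComplexIso (x • 𝟙 X) F ≪≫ eqToIso (by
    have : (F.mapHomologicalComplex (ComplexShape.up ℤ)).map (x • 𝟙 X) = x • 𝟙 _ := by
      ext i : 1
      change F.map (x • 𝟙 (X.X i)) = x • 𝟙 (F.obj (X.X i))
      rw [F.map_smul, F.map_id]
    rw [this])

lemma Fcone_fin [IsNoetherianRing R] (X : Cx R) (x : R) (hx : HK (Fc F X) x) :
    HFin (Fc F (Kz X x)) ↔ HFin (Fc F X) :=
  (HFin_iso (FcK F X x)).trans (cone_fin _ _ hx)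

lemma Fcone_kill_self (X : Cx R) (x : R) : HK (Fc F (Kz X x)) (x ^ 2) :=
  HK_iso (FcK F X x).symm _ (cone_kill_self _ _)

lemma Fcone_kill (X : Cx R) (x y : R) (h : HK (Fc F X) y) : HK (Fc F (Kz X x)) (y ^ 2) :=
  HK_iso (FcK F X x).symm _ (cone_kill _ _ _ h)

lemma HK_of (X : Cx R) (x : R) (h : ∀ A, x • 𝟙 (F.obj A) = 0) : HK (Fc F X) x := by
  intro i z
  have : x • 𝟙 (Fc F X) = 0 := by
    ext i : 1
    exact h (X.X i)
  have h2 := congr_arg (fun φ => HomologicalComplex.homologyMap φ i) this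
  simp only [homologyMap_smul', HomologicalComplex.homologyMap_id, HomologicalComplex.homologyMap_zero] at h2
  exact congr($h2 z)

/-- iterated cones -/
def KL (X : Cx R) : List R → Cx R
  | [] => X
  | x :: l => Kz (KL X l) x


lemma KL_fin [IsNoetherianRing R] (X : Cx R) (l : List R) (h : ∀ x ∈ l, ∀ A, x • 𝟙 (F.obj A) = 0) :
    HFin (Fc F (KL X l)) ↔ HFin (Fc F X) := by
  induction l with
  | nil => rfl
  | cons x l ih =>
    refine (Fcone_fin F _ x (HK_of F _ x (h x (by simp)))).trans (ih (fun x hx => h x (by simp [hx])))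

lemma KL_kill (X : Cx R) (l : List R) (x : R) (hx : x ∈ l) : HK (Fc F (KL X l)) (x ^ (2 ^ l.length)) := by
  induction l with
  | nil => simp at hx
  | cons y l ih =>
    rcases List.mem_cons.1 hx with rfl | hx
    · refine HK_dvd _ (Fcone_kill_self F (KL X l) x) (pow_dvd_pow x ?_)
      exact Nat.le_self_pow (by simp) 2
    · have := Fcone_kill F (KL X l) y _ (ih hx)
      rwa [← pow_mul, ← pow_succ] at this
end F
end Cof
end

section
open Limits
namespace Cof
variable {R : Type u} [CommRing R]
open MonoidalCategory

/-- tensor complex, functorial in the module -/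
def TX (X : Cx R) : ModuleCat.{u} R ⥤ Cx R where
  obj N := Fc (tensorLeft N) X
  map f := { f := fun i => f ▷ X.X i
             comm' := fun i j _ => by
              exact (whisker_exchange f (X.d i j)).symm }
  map_id N := by
    ext i : 1
    exact id_whiskerRight _ _
  map_comp f g := by
    ext i : 1
    exact comp_whiskerRight _ _ _

lemma TX_smul (X : Cx R) {A B : ModuleCat.{u} R} (r : R) (f : A ⟶ B) :
    (TX X).map (r • f) = r • (TX X).map f := by
  ext i : 1
  exact MonoidalLinear.smul_whiskerRight r f (X.X i)

instance (X : Cx R) : (TX X).Additive where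
  map_add {A B f g} := by
    ext i : 1
    exact MonoidalPreadditive.add_whiskerRight f g

/-- the Hom functor -/
abbrev HomF (N : ModuleCat.{u} R) : ModuleCat.{u} R ⥤ ModuleCat.{u} R :=
  (linearCoyoneda R (ModuleCat.{u} R)).obj (Opposite.op N)

instance (N : ModuleCat.{u} R) : (HomF N).Linear R where
  map_smul {A B} f r := by
    ext (g : N ⟶ A) : 2
    exact Linear.comp_smul _ _ _ g r f

def HX (J : Cx R) : (ModuleCat.{u} R)ᵒᵖ ⥤ Cx R where
  obj N := Fc (HomF N.unop) J
  map f := { f := fun i => ((linearCoyoneda R (ModuleCat.{u} R)).map f).app (J.X i)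
             comm' := fun i j _ => by
              exact (((linearCoyoneda R (ModuleCat.{u} R)).map f).naturality (J.d i j)).symm }
  map_id N := by
    ext i : 1
    exact congr_app ((linearCoyoneda R (ModuleCat.{u} R)).map_id N) _
  map_comp f g := by
    ext i : 1
    exact congr_app ((linearCoyoneda R (ModuleCat.{u} R)).map_comp f g) _

lemma HX_smul (X : Cx R) {A B : ModuleCat.{u} R} (r : R) (f : A ⟶ B) :
    (HX X).map (r • f).op = r • (HX X).map f.op := by
  ext i : 1
  apply ModuleCat.hom_ext
  apply LinearMap.ext
  intro (g : B ⟶ X.X i)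
  exact Linear.smul_comp _ _ _ r f g

instance (X : Cx R) : (HX X).Additive where
  map_add {A B f g} := by
    ext i : 1
    apply ModuleCat.hom_ext
    apply LinearMap.ext
    intro (h : _ ⟶ X.X i)
    exact Preadditive.add_comp _ _ _ f.unop g.unop h

/-- termwise projective -/
def TProj (X : Cx R) : Prop := ∀ i, Projective (X.X i)
def TInj (X : Cx R) : Prop := ∀ i, Injective (X.X i)
def BddA (X : Cx R) : Prop := ∃ B : ℤ, ∀ i, B < i → IsZero (X.X i)
def BddB (X : Cx R) : Prop := ∃ B : ℤ, ∀ i, i < B → IsZero (X.X i)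

lemma ses_T {X : Cx R} (hX : TProj X) {S : ShortComplex (ModuleCat.{u} R)} (hS : S.ShortExact) :
    (S.map (TX X)).ShortExact := by
  apply ses_cx
  intro i
  have := hX i
  have : Module.Projective R (X.X i) := (IsProjective.iff_projective (X.X i)).2 inferInstance
  have : Module.Flat R (X.X i) := inferInstance
  have h : (S.map (tensorRight (X.X i))).ShortExact := hS.map_of_exact _
  exact h

lemma ses_H {X : Cx R} (hX : TInj X) {S : ShortComplex (ModuleCat.{u} R)} (hS : S.ShortExact) :
    (S.op.map (HX X)).ShortExact := by
  apply ses_cx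
  intro i
  have := hX i
  have hm : Mono S.f := hS.mono_f
  have := hS.epi_g
  refine ModuleCat.shortComplex_shortExact _ ?_ ?_ ?_
  · intro (φ : S.X₂ ⟶ X.X i)
    constructor
    · intro (h : S.f ≫ φ = 0)
      exact ⟨hS.exact.desc φ h, hS.exact.g_desc φ h⟩
    · rintro ⟨(ψ : S.X₃ ⟶ X.X i), rfl⟩
      change S.f ≫ S.g ≫ ψ = 0
      rw [S.zero_assoc, zero_comp]
  · intro (φ : S.X₃ ⟶ X.X i) (φ' : S.X₃ ⟶ X.X i) (h : S.g ≫ φ = S.g ≫ φ')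
    exact (cancel_epi S.g).1 h
  · intro (φ : S.X₁ ⟶ X.X i)
    have h := @Injective.factors _ _ _ (hX i) _ _ φ S.f hm
    obtain ⟨ψ, hψ⟩ := h
    exact ⟨ψ, hψ⟩

def TP (X : Cx R) (i : ℤ) (N : ModuleCat.{u} R) : Prop :=
  Module.Finite R (((TX X).obj N).homology i)

def EP (X : Cx R) (i : ℤ) (N : ModuleCat.{u} R) : Prop :=
  Module.Finite R (((HX X).obj (Opposite.op N)).homology (-i))

lemma TP_sys [IsNoetherianRing R] (X : Cx R) (hX : TProj X) (hB : BddA X) : FinSys (TP X) where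
  zero i N hN := fin_of_zero i (((tensorRight (X.X i)).map_isZero hN))
  ext i S hS h1 h3 := lesf₂ (ses_T hX hS) i h1 h3
  quot i S hS h2 h1 := lesf₃ (ses_T hX hS) i (i+1) rfl h2 h1
  bdd := by
    obtain ⟨B, hB⟩ := hB
    exact ⟨B, fun i hi N => fin_of_zero i ((tensorLeft N).map_isZero (hB i hi))⟩

lemma EP_sys [IsNoetherianRing R] (X : Cx R) (hX : TInj X) (hB : BddB X) : FinSys (EP X) where
  zero i N hN := fin_of_zero (-i) (by
    refine ModuleCat.isZero_iff_subsingleton.2 ⟨fun (a : N ⟶ X.X (-i)) b => hN.eq_of_src a b⟩)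
  ext i S hS h1 h3 := lesf₂ (ses_H hX hS) (-i) h3 h1
  quot i S hS h2 h1 := lesf₁ (ses_H hX hS) (-(i+1)) (-i) (by omega) h2 h1
  bdd := by
    obtain ⟨B, hB⟩ := hB
    exact ⟨-B, fun i hi N => fin_of_zero (-i) ((HomF N).map_isZero (hB (-i) (by omega)))⟩

lemma TP_kill [IsNoetherianRing R] (X : Cx R) (hX : TProj X) (y : R)
    (hy : ∀ N, HK ((TX X).obj N) y) : FinKill (TP X) y := by
  intro i K N L C k p q c w w' hS hS' hpq hK hC
  refine fin_kill' (HomologicalComplex.homologyMap ((TX X).map p) i).hom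
    (HomologicalComplex.homologyMap ((TX X).map q) i).hom
    (HomologicalComplex.homologyMap ((TX X).map c) i).hom ((ses_T hX hS).δ i (i+1) rfl).hom
    (les₂ (ses_T hX hS') i) (les₃ (ses_T hX hS) i (i+1) rfl) ?_ hC hK
  intro b
  have h : HomologicalComplex.homologyMap ((TX X).map p) i ≫
    HomologicalComplex.homologyMap ((TX X).map q) i = y • 𝟙 _ := by
    rw [← HomologicalComplex.homologyMap_comp, ← Functor.map_comp, hpq, TX_smul,
      homologyMap_smul', CategoryTheory.Functor.map_id, HomologicalComplex.homologyMap_id]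
  exact (congr($h b)).trans (hy N i b)

lemma EP_kill [IsNoetherianRing R] (X : Cx R) (hX : TInj X) (y : R)
    (hy : ∀ N, HK ((HX X).obj N) y) : FinKill (EP X) y := by
  intro i K N L C k p q c w w' hS hS' hpq hK hC
  refine fin_kill (HomologicalComplex.homologyMap ((HX X).map c.op) (-i)).hom
    (HomologicalComplex.homologyMap ((HX X).map q.op) (-i)).hom
    (HomologicalComplex.homologyMap ((HX X).map p.op) (-i)).hom
    ((ses_H hX hS).δ (-(i+1)) (-i) (by simp)).hom
    (les₂ (ses_H hX hS') (-i)) (les₁ (ses_H hX hS) (-(i+1)) (-i) (by simp)) ?_ hC hK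
  intro b
  have h : HomologicalComplex.homologyMap ((HX X).map q.op) (-i) ≫
    HomologicalComplex.homologyMap ((HX X).map p.op) (-i) = y • 𝟙 _ := by
    rw [← HomologicalComplex.homologyMap_comp, ← Functor.map_comp, ← op_comp, hpq, HX_smul,
      homologyMap_smul', op_id, CategoryTheory.Functor.map_id, HomologicalComplex.homologyMap_id]
  exact (congr($h b)).trans (hy _ (-i) b)

end Cof
end

section
open Limits
namespace Cof
variable {R : Type u} [CommRing R]
open MonoidalCategory

lemma Kz_X (X : Cx R) (x : R) (i : ℤ) :
    Nonempty ((Kz X x).X i ≅ X.X (i+1) ⊞ X.X i) :=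
  ⟨HomologicalComplex.homotopyCofiber.XIsoBiprod (x • 𝟙 X) i (i+1) rfl⟩

lemma Kz_proj {X : Cx R} (x : R) (h : TProj X) : TProj (Kz X x) := by
  intro i
  obtain ⟨e⟩ := Kz_X X x i
  have := h i
  have := h (i+1)
  exact Projective.of_iso e.symm inferInstance

lemma Kz_inj {X : Cx R} (x : R) (h : TInj X) : TInj (Kz X x) := by
  intro i
  obtain ⟨e⟩ := Kz_X X x i
  have := h i
  have := h (i+1)
  exact Injective.of_iso e.symm inferInstance

lemma biprod_zero {A B : ModuleCat.{u} R} (hA : IsZero A) (hB : IsZero B) : IsZero (A ⊞ B) := by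
  rw [IsZero.iff_id_eq_zero]
  refine biprod.hom_ext' _ _ (hA.eq_of_src _ _) (hB.eq_of_src _ _)

lemma Kz_bddA {X : Cx R} (x : R) (h : BddA X) : BddA (Kz X x) := by
  obtain ⟨B, hB⟩ := h
  refine ⟨B, fun i hi => ?_⟩
  obtain ⟨e⟩ := Kz_X X x i
  exact (biprod_zero (hB _ (by omega)) (hB _ hi)).of_iso e

lemma Kz_bddB {X : Cx R} (x : R) (h : BddB X) : BddB (Kz X x) := by
  obtain ⟨B, hB⟩ := h
  refine ⟨B-1, fun i hi => ?_⟩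
  obtain ⟨e⟩ := Kz_X X x i
  exact (biprod_zero (hB _ (by omega)) (hB _ (by omega))).of_iso e

lemma KL_ind {P : Cx R → Prop} (hP : ∀ X x, P X → P (Kz X x)) (X : Cx R) (h : P X) (l : List R) :
    P (KL X l) := by
  induction l with
  | nil => exact h
  | cons x l ih => exact hP _ _ ih

section D
attribute [local instance] HasDerivedCategory.standard

/-- isomorphic in the derived category -/
def QI (X Y : Cx R) : Prop :=
  Nonempty (DerivedCategory.Q.obj X ≅ DerivedCategory.Q.obj Y)

lemma QI_of {X Y : Cx R} (f : X ⟶ Y) [QuasiIso f] : QI X Y :=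
  ⟨asIso (DerivedCategory.Q.map f)⟩

lemma QI.trans {X Y Z : Cx R} (h : QI X Y) (h' : QI Y Z) : QI X Z :=
  ⟨h.some ≪≫ h'.some⟩

lemma QI.fin {X Y : Cx R} (h : QI X Y) : HFin X ↔ HFin Y := by
  obtain ⟨e⟩ := h
  refine forall_congr' fun i => ?_
  have e1 := (DerivedCategory.homologyFunctorFactors (ModuleCat.{u} R) i).app X
  have e2 := (DerivedCategory.homologyFunctorFactors (ModuleCat.{u} R) i).app Y
  have e3 := (DerivedCategory.homologyFunctor (ModuleCat.{u} R) i).mapIso e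
  exact Module.Finite.equiv_iff (e1.symm ≪≫ e3 ≪≫ e2).toLinearEquiv

lemma QI.cone {X Y : Cx R} (h : QI X Y) (x : R) : QI (Kz X x) (Kz Y x) := by
  obtain ⟨e⟩ := h
  have h1 := DerivedCategory.mappingCone_triangle_distinguished (x • 𝟙 X)
  have h2 := DerivedCategory.mappingCone_triangle_distinguished (x • 𝟙 Y)
  have key (Z : Cx R) : DerivedCategory.Q.map (x • 𝟙 Z) = x • 𝟙 (DerivedCategory.Q.obj Z) := by
    rw [Functor.map_smul, CategoryTheory.Functor.map_id]
  have comm : DerivedCategory.Q.map (x • 𝟙 X) ≫ e.hom = e.hom ≫ DerivedCategory.Q.map (x • 𝟙 Y) := by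
    rw [key, key, Linear.smul_comp, Linear.comp_smul, Category.id_comp, Category.comp_id]
  have e' := Pretriangulated.isoTriangleOfIso₁₂ _ _ h1 h2 e e comm
  exact ⟨Pretriangulated.Triangle.π₃.mapIso e'⟩

lemma QI.KL {X Y : Cx R} (h : QI X Y) (l : List R) : QI (KL X l) (KL Y l) := by
  induction l with
  | nil => exact h
  | cons x l ih => exact ih.cone x

end D

def TX_self (X : Cx R) : (TX X).obj (ModuleCat.of R R) ≅ X :=
  HomologicalComplex.Hom.isoOfComponents (fun i => λ_ (X.X i)) (fun i j _ => by
    exact (leftUnitor_naturality (X.d i j)).symm)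

def homSelf (A : ModuleCat.{u} R) : (ModuleCat.of R R ⟶ A) ≃ₗ[R] A :=
  (ModuleCat.homLinearEquiv (S := R)).trans (LinearMap.ringLmapEquivSelf R R A)

def HX_self (X : Cx R) : (HX X).obj (Opposite.op (ModuleCat.of R R)) ≅ X :=
  HomologicalComplex.Hom.isoOfComponents (fun i => (homSelf (X.X i)).toModuleIso) (fun i j _ => by
    rfl)

lemma EP_iff (X : Cx R) (N : ModuleCat.{u} R) : (∀ i, EP X i N) ↔ HFin ((HX X).obj (Opposite.op N)) :=
  ⟨fun h i => by
    obtain ⟨k, rfl⟩ : ∃ k, i = -k := ⟨-i, by simp⟩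
    exact h k, fun h i => h (-i)⟩

lemma smul_tens (I : Ideal R) (x : R) (hx : x ∈ I) (A : ModuleCat.{u} R) :
    x • 𝟙 ((tensorLeft (ModuleCat.of R (R ⧸ I))).obj A) = 0 := by
  have h : x • 𝟙 (ModuleCat.of R (R ⧸ I)) = 0 := by
    apply ModuleCat.hom_ext
    apply LinearMap.ext
    intro a
    obtain ⟨a, rfl⟩ := Submodule.mkQ_surjective _ a
    change (Submodule.Quotient.mk (x * a) : R ⧸ I) = 0
    rw [Submodule.Quotient.mk_eq_zero]
    exact I.mul_mem_right _ hx
  have h2 := congr_arg (fun f => f ▷ A) h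
  simp only [MonoidalLinear.smul_whiskerRight, id_whiskerRight, MonoidalPreadditive.zero_whiskerRight] at h2
  exact h2

lemma smul_hom (I : Ideal R) (x : R) (hx : x ∈ I) (A : ModuleCat.{u} R) :
    x • 𝟙 ((HomF (ModuleCat.of R (R ⧸ I))).obj A) = 0 := by
  have h : x • 𝟙 (ModuleCat.of R (R ⧸ I)) = 0 := by
    apply ModuleCat.hom_ext
    apply LinearMap.ext
    intro a
    obtain ⟨a, rfl⟩ := Submodule.mkQ_surjective _ a
    change (Submodule.Quotient.mk (x * a) : R ⧸ I) = 0
    rw [Submodule.Quotient.mk_eq_zero]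
    exact I.mul_mem_right _ hx
  apply ModuleCat.hom_ext
  apply LinearMap.ext
  intro (f : ModuleCat.of R (R ⧸ I) ⟶ A)
  change x • f = 0
  rw [← Category.id_comp f, ← Linear.smul_comp, h, zero_comp]

lemma pow_le_span (l : List R) (k : ℕ) :
    ∃ m, Ideal.span {y | y ∈ l} ^ m ≤ Ideal.span {y | y ∈ l.map (· ^ k)} := by
  apply Ideal.exists_pow_le_of_le_radical_of_fg
  · rw [Ideal.span_le]
    intro y hy
    refine ⟨k, Ideal.subset_span ?_⟩
    exact List.mem_map.2 ⟨y, hy, rfl⟩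
  · classical exact ⟨l.toFinset, by congr 1; ext; simp⟩

theorem main_F [IsNoetherianRing R] (I : Ideal R) (X J : Cx R) (hX : TProj X) (hX' : BddA X)
    (hJ : TInj J) (hJ' : BddB J) (h : QI X J) :
    (∀ i, TP X i (ModuleCat.of R (R ⧸ I))) ↔ (∀ i, EP J i (ModuleCat.of R (R ⧸ I))) := by
  obtain ⟨s, hs⟩ := IsNoetherian.noetherian I
  let l := s.toList
  have hl : Ideal.span {y | y ∈ l} = I := by
    rw [← hs]; congr 1; ext; simp [l]
  have hlI : ∀ y ∈ l, y ∈ I := fun y hy => by rw [← hl]; exact Ideal.subset_span hy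
  let X' := KL X l
  let J' := KL J l
  have sX : FinSys (TP X') := TP_sys _ (KL_ind (P := TProj) (fun X x => Kz_proj x) X hX l)
    (KL_ind (P := BddA) (fun X x => Kz_bddA x) X hX' l)
  have sJ : FinSys (EP J') := EP_sys _ (KL_ind (P := TInj) (fun X x => Kz_inj x) J hJ l)
    (KL_ind (P := BddB) (fun X x => Kz_bddB x) J hJ' l)
  obtain ⟨m, hm⟩ := pow_le_span l (2 ^ l.length)
  rw [hl] at hm
  have kX : ∀ y ∈ l.map (· ^ (2 ^ l.length)), FinKill (TP X') y := by
    intro y hy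
    obtain ⟨x, hx, rfl⟩ := List.mem_map.1 hy
    exact TP_kill _ (KL_ind (P := TProj) (fun X x => Kz_proj x) X hX l) _
      (fun N => KL_kill (tensorLeft N) X l x hx)
  have kJ : ∀ y ∈ l.map (· ^ (2 ^ l.length)), FinKill (EP J') y := by
    intro y hy
    obtain ⟨x, hx, rfl⟩ := List.mem_map.1 hy
    exact EP_kill _ (KL_ind (P := TInj) (fun X x => Kz_inj x) J hJ l) _
      (fun N => KL_kill (HomF N.unop) J l x hx)
  have f1 : (∀ i, TP X' i (ModuleCat.of R (R ⧸ I))) ↔ (∀ i, TP X i (ModuleCat.of R (R ⧸ I))) :=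
    KL_fin (tensorLeft (ModuleCat.of R (R ⧸ I))) X l (fun x hx A => smul_tens I x (hlI x hx) A)
  have f2 : (∀ i, EP J' i (ModuleCat.of R (R ⧸ I))) ↔ (∀ i, EP J i (ModuleCat.of R (R ⧸ I))) := by
    rw [EP_iff, EP_iff]
    exact KL_fin (HomF (ModuleCat.of R (R ⧸ I))) J l (fun x hx A => smul_hom I x (hlI x hx) A)
  have g1 : (∀ i, TP X' i (ModuleCat.of R R)) ↔ HFin X' := HFin_iso (TX_self X')
  have g2 : (∀ i, EP J' i (ModuleCat.of R R)) ↔ HFin J' := by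
    rw [EP_iff]; exact HFin_iso (HX_self J')
  have g : (∀ i, TP X' i (ModuleCat.of R R)) ↔ (∀ i, EP J' i (ModuleCat.of R R)) := by
    rw [g1, g2]; exact (h.KL l).fin
  rw [← f1, ← f2]
  constructor
  · intro h
    exact fun i => sJ.of_self (g.1 (sX.to_self I _ kX m hm h)) i _
  · intro h
    exact fun i => sX.of_self (g.2 (sJ.to_self I _ kJ m hm h)) i _

end Cof
end

section
open Limits
namespace Cof
variable {R : Type u} [CommRing R]
open MonoidalCategory

section ExtLink
variable {Y : ModuleCat.{u} R} (Q : InjectiveResolution Y) (N : ModuleCat.{u} R)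

abbrev HQ : Cx R := (HX Q.cochainComplex).obj (Opposite.op N)

def iH (n : ℕ) (z : (HQ Q N).cycles (n:ℤ)) : N ⟶ Q.cochainComplex.X (n:ℤ) :=
  (HQ Q N).iCycles (n:ℤ) z

lemma iH_d (n : ℕ) (z) : iH Q N n z ≫ Q.cochainComplex.d (n:ℤ) ((n:ℤ)+1) = 0 :=
  cyc_d (HQ Q N) (n:ℤ) ((n:ℤ)+1) z

abbrev iH' (n : ℕ) (z : (HQ Q N).cycles (n:ℤ)) : N ⟶ Q.cocomplex.X n :=
  iH Q N n z ≫ (Q.cochainComplexXIso n n rfl).hom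

lemma iH'_d (n : ℕ) (z) : iH' Q N n z ≫ Q.cocomplex.d n (n+1) = 0 := by
  have h := iH_d Q N n z
  rw [Q.cochainComplex_d (n:ℤ) ((n:ℤ)+1) n (n+1) rfl (by simp)] at h
  rw [← cancel_mono (Q.cochainComplexXIso ((n:ℤ)+1) (n+1) (by simp)).inv, zero_comp, ← h]
  simp

lemma iH_add (n : ℕ) (z z') : iH Q N n (z + z') = iH Q N n z + iH Q N n z' :=
  map_add ((HQ Q N).iCycles (n:ℤ)).hom z z'

lemma iH_smul (n : ℕ) (r : R) (z) : iH Q N n (r • z) = r • iH Q N n z :=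
  map_smul ((HQ Q N).iCycles (n:ℤ)).hom r z

lemma ext_smul (n : ℕ) (r : R) (e : Abelian.Ext N Y n) :
    r • e = (Abelian.Ext.mk₀ (r • 𝟙 N)).comp e (zero_add n) := by
  rw [Abelian.Ext.mk₀_smul, Abelian.Ext.smul_comp, Abelian.Ext.mk₀_id_comp]

def injPsi (n : ℕ) : (HQ Q N).cycles (n:ℤ) →ₗ[R] Abelian.Ext N Y n where
  toFun z := Q.extMk (iH' Q N n z) (n+1) rfl (iH'_d Q N n z)
  map_add' z z' := by
    rw [Q.add_extMk]
    congr 1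
    rw [iH', iH_add, Preadditive.add_comp]
  map_smul' r z := by
    rw [ext_smul, RingHom.id_apply, Q.mk₀_comp_extMk]
    congr 1
    rw [iH', iH_smul]
    simp

lemma injPsi_apply (n : ℕ) (z) :
    injPsi Q N n z = Q.extMk (iH' Q N n z) (n+1) rfl (iH'_d Q N n z) := rfl

lemma injPsi_surj (n : ℕ) : Function.Surjective (injPsi Q N n) := by
  intro e
  obtain ⟨f, hf, rfl⟩ := Q.extMk_surjective e (n+1) rfl
  have hf' : (f ≫ (Q.cochainComplexXIso n n rfl).inv) ≫ Q.cochainComplex.d (n:ℤ) ((n:ℤ)+1) = 0 := by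
    rw [Q.cochainComplex_d (n:ℤ) ((n:ℤ)+1) n (n+1) rfl (by simp)]
    simp [reassoc_of% hf]
  obtain ⟨z, hz⟩ := cyc_ex (HQ Q N) (n:ℤ) ((n:ℤ)+1) (by simp)
    (f ≫ (Q.cochainComplexXIso n n rfl).inv) hf'
  refine ⟨z, ?_⟩
  rw [injPsi_apply]
  congr 1
  have : iH Q N n z = f ≫ (Q.cochainComplexXIso n n rfl).inv := hz
  rw [iH', this]
  simp

lemma injPsi_zero (n : ℕ) (z) : injPsi Q N n z = 0 ↔
    ∃ y : (HQ Q N).X ((n:ℤ)-1), (HQ Q N).d ((n:ℤ)-1) n y = (HQ Q N).iCycles n z := by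
  rw [injPsi_apply]
  simp only [← Q.extEquivCohomologyClass.apply_eq_iff_eq,
    InjectiveResolution.extEquivCohomologyClass_extMk, InjectiveResolution.extEquivCohomologyClass_zero,
    CochainComplex.HomComplex.CohomologyClass.mk_eq_zero_iff]
  rw [CochainComplex.HomComplex.Cocycle.fromSingleMk_mem_coboundaries_iff _ _ _ _ _ ((n:ℤ)-1) (by simp)]
  rw [iH', Category.assoc, Iso.hom_inv_id, Category.comp_id]
  rfl

lemma ext_link (n : ℕ) : EP Q.cochainComplex (-(n:ℤ)) N ↔ Module.Finite R (Abelian.Ext N Y n) := by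
  have h : Module.Finite R ((HQ Q N).homology (n:ℤ)) ↔ Module.Finite R (Abelian.Ext N Y n) :=
    finite_hom_iff ((n:ℤ)-1) (n:ℤ) (by simp) (injPsi Q N n) (injPsi_surj Q N n) (injPsi_zero Q N n)
  rw [← h]
  have h2 : ∀ k : ℤ, k = n → (Module.Finite R ((HQ Q N).homology k) ↔
    Module.Finite R ((HQ Q N).homology (n:ℤ))) := by
    rintro _ rfl; rfl
  exact h2 _ (neg_neg _)

lemma ext_link_all : (∀ i, EP Q.cochainComplex i N) ↔ ∀ n, Module.Finite R (Abelian.Ext N Y n) := by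
  constructor
  · intro h n
    exact (ext_link Q N n).1 (h _)
  · intro h i
    rcases le_or_gt i 0 with hi | hi
    · obtain ⟨n, hn⟩ := Int.exists_eq_neg_ofNat hi
      rw [hn]
      exact (ext_link Q N n).2 (h n)
    · exact fin_of_zero (-i) ((HomF N).map_isZero
        (Q.cochainComplex.isZero_of_isStrictlyGE 0 (-i) (by omega)))

end ExtLink

section TorLink

lemma sc_fin {S T : ShortComplex (ModuleCat.{u} R)} (φ : S ⟶ T) [Epi φ.τ₁] [IsIso φ.τ₂] [Mono φ.τ₃] :
    Module.Finite R S.homology ↔ Module.Finite R T.homology := by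
  have : ShortComplex.QuasiIso φ := ShortComplex.quasiIso_of_epi_of_isIso_of_mono φ
  exact Module.Finite.equiv_iff (asIso (ShortComplex.homologyMap φ)).toLinearEquiv

variable {M : ModuleCat.{u} R} (P : ProjectiveResolution M) (N : ModuleCat.{u} R)

lemma tor_link (n : ℕ) : TP P.cochainComplex (-(n:ℤ)) N ↔
    Module.Finite R (((Tor (ModuleCat.{u} R) n).obj N).obj M) := by
  let K := (TX P.cochainComplex).obj N
  let L := ((tensorLeft N).mapHomologicalComplex (ComplexShape.down ℕ)).obj P.complex
  have h1 : Module.Finite R (((Tor (ModuleCat.{u} R) n).obj N).obj M) ↔ Module.Finite R (L.homology n) :=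
    Module.Finite.equiv_iff (P.isoLeftDerivedObj (tensorLeft N) n).toLinearEquiv
  rw [h1]
  have h2 : TP P.cochainComplex (-(n:ℤ)) N ↔
    Module.Finite R (K.sc' (-((n:ℤ)+1)) (-n) (-n+1)).homology :=
    Module.Finite.equiv_iff (ShortComplex.homologyMapIso
      (K.isoSc' (-((n:ℤ)+1)) (-n) (-n+1) (by simp; omega) (by simp))).toLinearEquiv
  rw [h2]
  let e (k : ℤ) (m : ℕ) (h : -(m:ℤ) = k) : K.X k ≅ L.X m := (tensorLeft N).mapIso (P.cochainComplexXIso k m h)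
  have he : ∀ k m h k' m' h', K.d k k' ≫ (e k' m' h').hom = (e k m h).hom ≫ L.d m m' := by
    intro k m h k' m' h'
    change (tensorLeft N).map _ ≫ (tensorLeft N).map _ = (tensorLeft N).map _ ≫ (tensorLeft N).map _
    rw [← Functor.map_comp, ← Functor.map_comp, P.cochainComplex_d k k' m m' h h']
    simp
  cases n with
  | zero =>
    have h3 : Module.Finite R (L.homology 0) ↔ Module.Finite R (L.sc' 1 0 0).homology :=
      Module.Finite.equiv_iff (ShortComplex.homologyMapIso
        (L.isoSc' 1 0 0 (by simp) (by simp))).toLinearEquiv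
    rw [h3]
    have hz : IsZero (K.X (-((0:ℕ):ℤ)+1)) := (tensorLeft N).map_isZero
      (P.cochainComplex.isZero_of_isStrictlyLE 0 _ (by simp))
    have hc : (e _ 0 rfl).hom ≫ L.d 0 0 = (0 : K.X (-((0:ℕ):ℤ)) ⟶ L.X 0) := by
      rw [L.shape _ _ (by simp), comp_zero]
    let φ : K.sc' (-(((0:ℕ):ℤ)+1)) (-((0:ℕ):ℤ)) (-((0:ℕ):ℤ)+1) ⟶ L.sc' 1 0 0 :=
      { τ₁ := (e _ 1 (by simp)).hom
        τ₂ := (e _ 0 rfl).hom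
        τ₃ := 0
        comm₁₂ := (he _ _ _ _ _ _).symm
        comm₂₃ := hc.trans comp_zero.symm }
    have : Epi φ.τ₁ := inferInstanceAs (Epi (e _ 1 _).hom)
    have : IsIso φ.τ₂ := inferInstanceAs (IsIso (e _ 0 _).hom)
    have : Mono φ.τ₃ := ⟨fun a b _ => hz.eq_of_tgt a b⟩
    exact sc_fin φ
  | succ n =>
    have h3 : Module.Finite R (L.homology (n+1)) ↔ Module.Finite R (L.sc' (n+2) (n+1) n).homology :=
      Module.Finite.equiv_iff (ShortComplex.homologyMapIso
        (L.isoSc' (n+2) (n+1) n (by simp) (by simp))).toLinearEquiv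
    rw [h3]
    let φ : K.sc' (-(((n+1:ℕ):ℤ)+1)) (-((n+1:ℕ):ℤ)) (-((n+1:ℕ):ℤ)+1) ⟶ L.sc' (n+2) (n+1) n :=
      { τ₁ := (e _ (n+2) (by simp; ring)).hom
        τ₂ := (e _ (n+1) rfl).hom
        τ₃ := (e _ n (by simp)).hom
        comm₁₂ := (he _ _ _ _ _ _).symm
        comm₂₃ := (he _ _ _ _ _ _).symm }
    have : Epi φ.τ₁ := inferInstanceAs (Epi (e _ _ _).hom)
    have : IsIso φ.τ₂ := inferInstanceAs (IsIso (e _ _ _).hom)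
    have : Mono φ.τ₃ := inferInstanceAs (Mono (e _ _ _).hom)
    exact sc_fin φ

lemma tor_pos (i : ℤ) (hi : 0 < i) : TP P.cochainComplex i N :=
  fin_of_zero i ((tensorLeft N).map_isZero (P.cochainComplex.isZero_of_isStrictlyLE 0 _ (by simpa)))

/-- the homology of `P ⊗ X` vanishes in negative degree for `P` flat -/
lemma tor_flat (i : ℤ) (hi : i < 0) [Module.Flat R N] :
    Subsingleton (((TX P.cochainComplex).obj N).homology i) := by
  have h0 : QuasiIso P.π' := inferInstance
  have h1 : QuasiIso (((tensorLeft N).mapHomologicalComplex (ComplexShape.up ℤ)).map P.π') := inferInstance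
  have h2 : IsIso (HomologicalComplex.homologyMap (((tensorLeft N).mapHomologicalComplex (ComplexShape.up ℤ)).map P.π') i) := inferInstance
  have hz : IsZero ((((tensorLeft N).mapHomologicalComplex (ComplexShape.up ℤ)).obj
      ((CochainComplex.singleFunctor (ModuleCat.{u} R) 0).obj M)).homology i) := by
    apply ShortComplex.isZero_homology_of_isZero_X₂
    exact (tensorLeft N).map_isZero (HomologicalComplex.isZero_single_obj_X _ _ _ _ (by omega))
  have := hz.of_iso (asIso (HomologicalComplex.homologyMap (((tensorLeft N).mapHomologicalComplex (ComplexShape.up ℤ)).map P.π') i))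
  exact ModuleCat.isZero_iff_subsingleton.1 this

end TorLink
end Cof
end

open Limits
namespace Cof
variable {R : Type u} [CommRing R]
open MonoidalCategory

abbrev Om (A : ModuleCat.{u} R) : ShortComplex (ModuleCat.{u} R) :=
  ShortComplex.mk (kernel.ι (Projective.π A)) (Projective.π A) (kernel.condition _)

lemma Om_exact (A : ModuleCat.{u} R) : (Om A).ShortExact where
  exact := ShortComplex.exact_of_f_is_kernel _ (kernelIsKernel _)
  mono_f := inferInstanceAs (Mono (kernel.ι _))
  epi_g := inferInstanceAs (Epi (Projective.π A))

def OmMap {A B : ModuleCat.{u} R} (f : A ⟶ B) : Om A ⟶ Om B where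
  τ₁ := kernel.map (Projective.π A) (Projective.π B)
    (Projective.factorThru (Projective.π A ≫ f) (Projective.π B)) f (by simp)
  τ₂ := Projective.factorThru (Projective.π A ≫ f) (Projective.π B)
  τ₃ := f
  comm₁₂ := by simp
  comm₂₃ := by simp

variable {M : ModuleCat.{u} R} (P : ProjectiveResolution M)

lemma P_proj : TProj P.cochainComplex := fun i => inferInstance

lemma om_delta {A B : ModuleCat.{u} R} (f : A ⟶ B) (i j : ℤ) (hij : i + 1 = j) :
    HomologicalComplex.homologyMap ((TX P.cochainComplex).map f) i ≫
      (ses_T (P_proj P) (Om_exact B)).δ i j hij =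
    (ses_T (P_proj P) (Om_exact A)).δ i j hij ≫
      HomologicalComplex.homologyMap ((TX P.cochainComplex).map (OmMap f).τ₁) j :=
  (HomologicalComplex.HomologySequence.δ_naturality
    ((TX P.cochainComplex).mapShortComplex.map (OmMap f))
    (ses_T (P_proj P) (Om_exact A)) (ses_T (P_proj P) (Om_exact B)) i j hij).symm

lemma om_zero {A B : ModuleCat.{u} R} (f : A ⟶ B) (i j : ℤ) (hij : i + 1 = j) (hi : i < 0)
    (h : (ses_T (P_proj P) (Om_exact A)).δ i j hij ≫
      HomologicalComplex.homologyMap ((TX P.cochainComplex).map (OmMap f).τ₁) j = 0) :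
    HomologicalComplex.homologyMap ((TX P.cochainComplex).map f) i = 0 := by
  rw [← om_delta P f i j hij] at h
  have hp : Module.Projective R (Projective.over B : ModuleCat.{u} R) :=
    (IsProjective.iff_projective _).2 (Projective.projective_over B)
  have hs := tor_flat P (Projective.over B) i hi
  ext x
  have h2 : (ses_T (P_proj P) (Om_exact B)).δ i j hij
      (HomologicalComplex.homologyMap ((TX P.cochainComplex).map f) i x) = 0 :=
    ConcreteCategory.congr_hom h x
  obtain ⟨a, ha⟩ := les₃ (ses_T (P_proj P) (Om_exact B)) i j hij _ h2
  have ha0 : a = 0 := hs.elim _ _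
  rw [ha0, map_zero] at ha
  exact ha.symm

lemma ext_om {A B : ModuleCat.{u} R} (f : A ⟶ B) (j k : ℕ) (hk : 1 + j = k)
    (h : ∀ (D : ModuleCat.{u} R) (e : Abelian.Ext B D k), pb f e = 0)
    (D : ModuleCat.{u} R) (e : Abelian.Ext (Om B).X₁ D j) :
    (Om_exact A).extClass.comp (pb (OmMap f).τ₁ e) hk = 0 := by
  have h1 := h D ((Om_exact B).extClass.comp e hk)
  rw [pb, ← Abelian.Ext.comp_assoc (a₁₂ := 1) _ _ _ (by omega) (by omega) (by omega)] at h1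
  rw [pb, ← Abelian.Ext.comp_assoc (a₁₂ := 1) _ _ _ (by omega) (by omega) (by omega),
    ShortComplex.ShortExact.extClass_naturality (Om_exact A) (Om_exact B) (OmMap f)]
  exact h1

lemma transfer (j : ℕ) : ∀ {A B : ModuleCat.{u} R} (f : A ⟶ B)
    (_ : ∀ (D : ModuleCat.{u} R) (e : Abelian.Ext B D (j+1)), pb f e = 0) (i : ℤ)
    (_ : i = -((j:ℤ)+1)),
    HomologicalComplex.homologyMap ((TX P.cochainComplex).map f) i = 0 := by
  induction j with
  | zero =>
    intro A B f h i hi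
    apply om_zero P f i (i+1) rfl (by omega)
    have h1 := ext_om f 0 1 rfl h _ (Abelian.Ext.mk₀ (𝟙 _))
    obtain ⟨x, hx⟩ := Abelian.Ext.contravariant_sequence_exact₁ (Om_exact A) _ _ _ h1
    obtain ⟨g, rfl⟩ := (Abelian.Ext.mk₀_bijective _ _).2 x
    have hg : (Om A).f ≫ g = (OmMap f).τ₁ := by
      apply (Abelian.Ext.mk₀_bijective _ _).1
      rw [← Abelian.Ext.mk₀_comp_mk₀, hx]
      simp [pb]
    rw [← hg, Functor.map_comp, HomologicalComplex.homologyMap_comp]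
    have h3 := (ses_T (P_proj P) (Om_exact A)).δ_comp i (i+1) rfl
    exact (Category.assoc _ _ _).symm.trans ((congrArg (· ≫ _) h3).trans zero_comp)
  | succ j ih =>
    intro A B f h i hi
    apply om_zero P f i (i+1) rfl (by push_cast at hi; omega)
    refine (congrArg (_ ≫ ·) (ih (OmMap f).τ₁ ?_ (i+1) (by push_cast at hi; omega))).trans comp_zero
    intro D e
    have h1 := ext_om f (j+1) (j+2) (by omega) h D e
    obtain ⟨x, hx⟩ := Abelian.Ext.contravariant_sequence_exact₁ (Om_exact A) _ _ _ h1
    have hx0 : x = 0 := Abelian.Ext.eq_zero_of_projective (P := Projective.over A) x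
    rw [← hx, hx0, Abelian.Ext.comp_zero]

lemma step [IsNoetherianRing R] (I : Ideal R) (m : ℕ) (hk : Kill I (m+1))
    (h : ∀ i : ℤ, -(m:ℤ) ≤ i → TP P.cochainComplex i (ModuleCat.of R (R ⧸ I))) :
    TP P.cochainComplex (-((m:ℤ)+1)) (ModuleCat.of R (R ⧸ I)) := by
  obtain ⟨s, hs, hz⟩ := hk I 1 (by simp)
  have h0 := transfer P m (pj hs) hz (-((m:ℤ)+1)) rfl
  have hB : BddA P.cochainComplex := ⟨0, fun i hi => P.cochainComplex.isZero_of_isStrictlyLE 0 i hi⟩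
  have hker : TP P.cochainComplex (-(m:ℤ)) (ModuleCat.of R (KK (I^s) I hs)) := by
    refine (TP_sys _ (P_proj P) hB).fg I (-(m:ℤ)) h (-(m:ℤ)) le_rfl _ inferInstance s ?_
    rintro r hr ⟨x, hx⟩
    apply Subtype.ext
    obtain ⟨x, rfl⟩ := Submodule.mkQ_surjective _ x
    change (Submodule.Quotient.mk (r * x) : R ⧸ I^s) = 0
    rw [Submodule.Quotient.mk_eq_zero]
    exact Ideal.mul_mem_right _ _ hr
  have hS := ses_T (P_proj P) (SS_exact hs)
  have hij : -((m:ℤ)+1) + 1 = -(m:ℤ) := by ring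
  refine fin_mid (A := PUnit.{u+1}) 0 (hS.δ _ _ hij).hom (fun b hb => ⟨0, ?_⟩) inferInstance hker
  obtain ⟨a, ha⟩ := les₃ hS _ _ hij b hb
  have : HomologicalComplex.homologyMap ((TX P.cochainComplex).map (pj hs)) (-((m:ℤ)+1)) a = b := ha
  rw [h0] at this
  exact this

end Cof

open Cof in
theorem stmt4' (R : Type u) [CommRing R] [IsNoetherianRing R] [IsLocalRing R] (I : Ideal R)
    (M : Type u) [AddCommGroup M] [Module R M] (n : ℕ)
    (hcd₁ : ∀ i : ℕ, n < i → Subsingleton ((localCohomology I i).obj (ModuleCat.of R R))) :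
    (∀ i : ℕ, Module.Finite R (((Ext R (ModuleCat.{u} R) i).obj (Opposite.op (ModuleCat.of R (R ⧸ I)))).obj (ModuleCat.of R M))) ↔
      ∀ i : ℕ, i ≤ n →
        Module.Finite R (((Tor (ModuleCat.{u} R) i).obj (ModuleCat.of R (R ⧸ I))).obj (ModuleCat.of R M)) := by
  let P := projectiveResolution (ModuleCat.of R M)
  let Q := injectiveResolution (ModuleCat.of R M)
  have hB : BddA P.cochainComplex := ⟨0, fun i hi => P.cochainComplex.isZero_of_isStrictlyLE 0 i hi⟩
  have hB' : BddB Q.cochainComplex := ⟨0, fun i hi => Q.cochainComplex.isZero_of_isStrictlyGE 0 i hi⟩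
  have hq : QI P.cochainComplex Q.cochainComplex := (QI_of P.π').trans (QI_of Q.ι')
  have hF := main_F I _ _ (P_proj P) hB (fun i => inferInstance) hB' hq
  have h1 : (∀ i : ℕ, Module.Finite R (((Ext R (ModuleCat.{u} R) i).obj (Opposite.op (ModuleCat.of R (R ⧸ I)))).obj (ModuleCat.of R M))) ↔ ∀ i, EP Q.cochainComplex i (ModuleCat.of R (R ⧸ I)) := by
    rw [ext_link_all]
    exact forall_congr' fun i => finite_ext_iff i _ _
  rw [h1, ← hF]
  constructor
  · intro h i _
    exact (tor_link P _ i).1 (h _)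
  · intro h
    have hk := kill_all I n (fun j hj => van_of_lc I j _ (hcd₁ j hj))
    have h2 : ∀ m : ℕ, n ≤ m → ∀ i : ℤ, -(m:ℤ) ≤ i → TP P.cochainComplex i (ModuleCat.of R (R ⧸ I)) := by
      intro m hm
      induction m, hm using Nat.le_induction with
      | base =>
        intro i hi
        rcases le_or_gt i 0 with h0 | h0
        · obtain ⟨k, rfl⟩ := Int.exists_eq_neg_ofNat h0
          exact (tor_link P _ k).2 (h k (by omega))
        · exact tor_pos P _ i h0
      | succ m hm ih =>
        intro i hi
        rcases eq_or_lt_of_le hi with h0 | h0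
        · have := step P I m (hk (m+1) (by omega)) ih
          rw [← h0]
          simpa using this
        · exact ih i (by push_cast at h0; omega)
    intro i
    exact h2 (n + i.natAbs) (by omega) i (by omega)

theorem stmt4 (R : Type u) [CommRing R] [IsNoetherianRing R] [IsLocalRing R] (I : Ideal R)
    (M : Type u) [AddCommGroup M] [Module R M] (n : ℕ)
    (hcd₁ : ∀ i : ℕ, n < i → Subsingleton (LC R I i (ModuleCat.of R R)))
    (hcd₂ : ∀ m : ℕ, (∀ i : ℕ, m < i → Subsingleton (LC R I i (ModuleCat.of R R))) → n ≤ m)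
    (hsupp : Module.support R M ⊆ PrimeSpectrum.zeroLocus (I : Set R)) :
    IsCofinite R I (ModuleCat.of R M) ↔
      ∀ i : ℕ, i ≤ n →
        Module.Finite R (TorMod R i (ModuleCat.of R (R ⧸ I)) (ModuleCat.of R M)) :=
  ⟨fun h => (stmt4' R I M n hcd₁).1 h.2, fun h => ⟨hsupp, (stmt4' R I M n hcd₁).2 h⟩⟩
end
end

section
/- Let (R, m) be a commutative Noetherian local ring and I an ideal of R with cd(I, R) ≤ 1. Then the category of I-cofinite R-modules is an Abelian subcategory of the category of all R-modules; that is, for any R-homomorphism f : M → N between I-cofinite modules, both ker f and coker f are I-cofinite. -/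
open CategoryTheory

noncomputable section

universe u

section mine

open CategoryTheory Abelian Limits

section bridge

variable {R : Type u} [CommRing R]

/-- relation -/
def ERel {X : ModuleCat.{u} R} (P : ProjectiveResolution X) (n : ℕ) (Y : ModuleCat.{u} R)
   (c : ExtMod R n X Y) (f : P.complex.X n ⟶ Y) : Prop :=
  ((P.complex.linearYonedaObj R Y).homologyι n).hom ((P.isoExt n Y).hom.hom c) = 
    ((P.complex.linearYonedaObj R Y).pOpcycles n).hom f

lemma ERel_exists {X : ModuleCat.{u} R} (P : ProjectiveResolution X) (n : ℕ) (Y : ModuleCat.{u} R)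
   (f : P.complex.X n ⟶ Y) (hf : P.complex.d (n+1) n ≫ f = 0) : ∃ c, ERel P n Y c f := by
  let K := P.complex.linearYonedaObj R Y
  let z := K.cyclesMk (i := n) f (n+1) (by simp) (by exact hf)
  have hz : (K.iCycles n).hom z = f := K.i_cyclesMk (i := n) f (n+1) (by simp) (by exact hf)
  refine ⟨(P.isoExt n Y).inv.hom ((K.homologyπ n).hom z), ?_⟩
  unfold ERel
  have : (P.isoExt n Y).hom.hom ((P.isoExt n Y).inv.hom ((K.homologyπ n).hom z)) =
    (K.homologyπ n).hom z := by
    rw [← ModuleCat.comp_apply, Iso.inv_hom_id]; rfl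
  erw [this]
  rw [← ModuleCat.comp_apply, K.homology_π_ι n, ModuleCat.comp_apply, hz]

lemma range_prev {X : ModuleCat.{u} R} (P : ProjectiveResolution X) (n p : ℕ) (hp : p + 1 = n) (Y : ModuleCat.{u} R)
   (f : P.complex.X n ⟶ Y) : ((P.complex.linearYonedaObj R Y).pOpcycles n).hom f = 0 ↔ 
    ∃ g : P.complex.X p ⟶ Y, P.complex.d n p ≫ g = f := by
  subst hp
  let K := P.complex.linearYonedaObj R Y
  have := (K.sc (p+1)).moduleCat_pOpcycles_eq_zero_iff f
  refine this.trans ?_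
  have h2 : (ComplexShape.up ℕ).prev (p+1) = p := by simp
  have key : ∀ q, q = p → (f ∈ LinearMap.range (K.d q (p+1)).hom ↔
      ∃ g : P.complex.X p ⟶ Y, P.complex.d (p+1) p ≫ g = f) := by
    rintro q rfl
    rfl
  exact key _ h2

lemma range_prev_zero {X : ModuleCat.{u} R} (P : ProjectiveResolution X) (Y : ModuleCat.{u} R)
   (f : P.complex.X 0 ⟶ Y) :
   ((P.complex.linearYonedaObj R Y).pOpcycles 0).hom f = 0 ↔ f = 0 := by
  let K := P.complex.linearYonedaObj R Y
  refine ((K.sc 0).moduleCat_pOpcycles_eq_zero_iff f).trans ?_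
  have h0 : (K.sc 0).f = 0 := by
    apply K.shape
    simp
  rw [h0]
  constructor
  · rintro ⟨g, hg⟩
    exact hg.symm
  · rintro rfl
    exact Submodule.zero_mem _

lemma ERel_zero_iff {X : ModuleCat.{u} R} (P : ProjectiveResolution X) (n : ℕ) (Y : ModuleCat.{u} R)
   (c) (f : P.complex.X n ⟶ Y) (h : ERel P n Y c f) :
    c = 0 ↔ ((P.complex.linearYonedaObj R Y).pOpcycles n).hom f = 0 := by
  unfold ERel at h
  rw [← h]
  constructor
  · rintro rfl
    erw [map_zero]
    exact map_zero _
  · intro h'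
    have h1 : Function.Injective ((P.complex.linearYonedaObj R Y).homologyι n).hom :=
      (ModuleCat.mono_iff_injective _).1 inferInstance
    have h2 : Function.Injective (P.isoExt n Y).hom.hom :=
      (ModuleCat.mono_iff_injective (P.isoExt (R := R) n Y).hom).1 inferInstance
    apply h2
    apply h1
    rw [h']
    have h3 : (P.isoExt n Y).hom.hom (0 : ExtMod R n X Y) = 0 := map_zero (P.isoExt n Y).hom.hom
    erw [h3]
    exact (map_zero _).symm

lemma cat_square_aux {C : Type*} [Category C] {A B A' B' D E : C} (m : D ⟶ E) (p : D ⟶ A) (p' : E ⟶ B)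
    (u : A' ≅ A) (u' : B' ≅ B) (t : A ⟶ B) (Ψ : A' ⟶ B') (e1 : m ≫ p' = p ≫ t)
    (e2 : u.hom ≫ t = Ψ ≫ u'.hom) : m ≫ p' ≫ u'.inv = (p ≫ u.inv) ≫ Ψ := by
  have e3 : t ≫ u'.inv = u.inv ≫ Ψ := by
    rw [Iso.comp_inv_eq, Category.assoc, ← e2, Iso.inv_hom_id_assoc]
  rw [Category.assoc, ← e3, ← Category.assoc, e1, Category.assoc]

lemma ERel_nat {X X' : ModuleCat.{u} R} (P : ProjectiveResolution X) (P' : ProjectiveResolution X')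
    (n : ℕ) (Y : ModuleCat.{u} R) (g : X' ⟶ X) (φ : ProjectiveResolution.Hom P' P g)
    (c : ExtMod R n X Y) (f : P.complex.X n ⟶ Y) (h : ERel P n Y c f) :
    ERel P' n Y ((((Ext R (ModuleCat.{u} R) n).map g.op).app Y).hom c) (φ.hom.f n ≫ f) := by
  let F := ((linearYoneda R (ModuleCat.{u} R)).obj Y).rightOp
  let K := P.complex.linearYonedaObj R Y
  let K' := P'.complex.linearYonedaObj R Y
  let Φ : K ⟶ K' := (HomologicalComplex.unopFunctor _ _).map
     (((F.mapHomologicalComplex _).map φ.hom).op)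
  have h1 : ((Ext R (ModuleCat.{u} R) n).map g.op).app Y ≫ (P'.isoExt n Y).hom =
    (P.isoExt n Y).hom ≫ HomologicalComplex.homologyMap Φ n := by
    have e1 := ProjectiveResolution.isoLeftDerivedObj_inv_naturality g P' P φ.hom
      φ.hom_f_zero_comp_π_f_zero F n
    have e2 := HomologicalComplex.homologyOp_hom_naturality Φ n
    exact cat_square_aux ((F.leftDerived n).map g).unop (P.isoLeftDerivedObj F n).inv.unop
      (P'.isoLeftDerivedObj F n).inv.unop (HomologicalComplex.homologyUnop
         ((F.mapHomologicalComplex _).obj P.complex) n) (HomologicalComplex.homologyUnop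
         ((F.mapHomologicalComplex _).obj P'.complex) n)
      (HomologicalComplex.homologyMap ((F.mapHomologicalComplex _).map φ.hom) n).unop
      (HomologicalComplex.homologyMap Φ n) (congrArg Quiver.Hom.unop e1)
      (congrArg Quiver.Hom.unop e2)
  have h2 := congr($(h1).hom c)
  unfold ERel at h ⊢
  erw [h2]
  change ((HomologicalComplex.homologyMap Φ n ≫ K'.homologyι n)).hom 
    ((P.isoExt n Y).hom.hom c) = _
  rw [HomologicalComplex.homologyι_naturality]
  change (HomologicalComplex.opcyclesMap Φ n).hom (_) = _
  erw [h]
  change (K.pOpcycles n ≫ HomologicalComplex.opcyclesMap Φ n).hom f = _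
  rw [HomologicalComplex.p_opcyclesMap]
  rfl

lemma ERel_surj {X : ModuleCat.{u} R} (P : ProjectiveResolution X) (n : ℕ) (Y : ModuleCat.{u} R)
   (c : ExtMod R n X Y) : ∃ f, P.complex.d (n+1) n ≫ f = 0 ∧ ERel P n Y c f := by
  let K := P.complex.linearYonedaObj R Y
  have h1 : Function.Surjective (K.homologyπ n).hom :=
      (ModuleCat.epi_iff_surjective _).1 inferInstance
  obtain ⟨z, hz⟩ := h1 ((P.isoExt n Y).hom.hom c)
  refine ⟨(K.iCycles n).hom z, ?_, ?_⟩
  · have := K.iCycles_d n (n+1)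
    exact congr($(this).hom z)
  · unfold ERel
    erw [← hz]
    rw [← ModuleCat.comp_apply, K.homology_π_ι n, ModuleCat.comp_apply]

end bridge

section bridge2

variable {R : Type u} [CommRing R]

lemma ERel_inj {X : ModuleCat.{u} R} (P : ProjectiveResolution X) (n : ℕ) (Y : ModuleCat.{u} R)
   (c c' : ExtMod R n X Y) (f : P.complex.X n ⟶ Y) (h : ERel P n Y c f) (h' : ERel P n Y c' f) :
    c = c' := by
  have h1 : Function.Injective ((P.complex.linearYonedaObj R Y).homologyι n).hom :=
      (ModuleCat.mono_iff_injective _).1 inferInstance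
  have h2 : Function.Injective (P.isoExt n Y).hom.hom :=
      (ModuleCat.mono_iff_injective (P.isoExt (R := R) n Y).hom).1 inferInstance
  exact h2 (h1 (h.trans h'.symm))

lemma ERel_add {X : ModuleCat.{u} R} (P : ProjectiveResolution X) (n : ℕ) (Y : ModuleCat.{u} R)
   (c c' : ExtMod R n X Y) (f f' : P.complex.X n ⟶ Y) (h : ERel P n Y c f) (h' : ERel P n Y c' f') :
    ERel P n Y (c + c') (f + f') := by
  unfold ERel at *
  have e1 : (P.isoExt n Y).hom.hom (c + c') = (P.isoExt n Y).hom.hom c + (P.isoExt n Y).hom.hom c' :=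
    map_add (P.isoExt n Y).hom.hom c c'
  erw [e1, map_add, h, h']
  exact (map_add ((P.complex.linearYonedaObj R Y).pOpcycles n).hom f f').symm

lemma ERel_smul {X : ModuleCat.{u} R} (P : ProjectiveResolution X) (n : ℕ) (Y : ModuleCat.{u} R)
   (r : R) (c : ExtMod R n X Y) (f : P.complex.X n ⟶ Y) (h : ERel P n Y c f) :
    ERel P n Y (r • c) (r • f) := by
  unfold ERel at *
  have e1 : (P.isoExt n Y).hom.hom (r • c) = r • (P.isoExt n Y).hom.hom c :=
    map_smul (P.isoExt n Y).hom.hom r c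
  erw [e1, map_smul, h]
  exact (map_smul ((P.complex.linearYonedaObj R Y).pOpcycles n).hom r f).symm

lemma extMk_zero_iff_zero {X : ModuleCat.{u} R} (P : ProjectiveResolution X) (Y : ModuleCat.{u} R)
    (f : P.complex.X 0 ⟶ Y) (hf : P.complex.d 1 0 ≫ f = 0) :
    P.extMk f 1 rfl hf = 0 ↔ f = 0 := by
  constructor
  · intro h
    simp only [← P.extEquivCohomologyClass.apply_eq_iff_eq,
      ProjectiveResolution.extEquivCohomologyClass_extMk,
      ProjectiveResolution.extEquivCohomologyClass_zero,
      CochainComplex.HomComplex.CohomologyClass.mk_eq_zero_iff] at h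
    rw [CochainComplex.HomComplex.Cocycle.toSingleMk_mem_coboundaries_iff _ _ _ _ _ 1 (by simp)] at h
    obtain ⟨g, hg⟩ := h
    have hz : IsZero (P.cochainComplex.X 1) := by
      apply CochainComplex.isZero_of_isStrictlyLE _ 0 1 (by simp)
    rw [hz.eq_of_src g 0, comp_zero] at hg
    rw [← cancel_epi (P.cochainComplexXIso (-(0:ℕ)) 0 rfl).hom, ← hg, comp_zero]
  · rintro rfl
    exact P.extMk_zero 1 rfl

lemma extMk_zero_iff' {X : ModuleCat.{u} R} (P : ProjectiveResolution X) (Y : ModuleCat.{u} R) (n : ℕ)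
    (f : P.complex.X n ⟶ Y) (hf : P.complex.d (n+1) n ≫ f = 0) :
    P.extMk f (n+1) rfl hf = 0 ↔ ((P.complex.linearYonedaObj R Y).pOpcycles n).hom f = 0 := by
  cases n with
  | zero => rw [range_prev_zero]; exact extMk_zero_iff_zero P Y f hf
  | succ p => rw [range_prev P (p+1) p rfl, P.extMk_eq_zero_iff f _ _ hf p rfl]

/-- cocycles -/
def coc {X : ModuleCat.{u} R} (P : ProjectiveResolution X) (Y : ModuleCat.{u} R) (n : ℕ) :
    Submodule R (P.complex.X n ⟶ Y) where
  carrier := {f | P.complex.d (n+1) n ≫ f = 0}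
  add_mem' := by
    intro a b (ha : _ = _) (hb : _ = _)
    change _ = _
    rw [Preadditive.comp_add, ha, hb, add_zero]
  zero_mem' := by simp
  smul_mem' := by
    intro r a (ha : _ = _)
    change _ = _
    rw [Linear.comp_smul, ha, smul_zero]

noncomputable def cocA {X : ModuleCat.{u} R} (P : ProjectiveResolution X) (Y : ModuleCat.{u} R) (n : ℕ) :
    coc P Y n →ₗ[R] Abelian.Ext X Y n where
  toFun f := P.extMk f.1 (n+1) rfl f.2
  map_add' f g := by
    exact (P.add_extMk f.1 g.1 (n+1) rfl f.2 g.2).symm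
  map_smul' r f := by
    have hf : P.complex.d (n+1) n ≫ f.1 = 0 := f.2
    have h1 : (r • f).1 = f.1 ≫ (r • 𝟙 Y) := by simp
    have h2 : P.complex.d (n+1) n ≫ (r • f).1 = 0 := (r • f).2
    have h3 : ∀ (a b : P.complex.X n ⟶ Y) (ha : P.complex.d (n+1) n ≫ a = 0)
      (hb : P.complex.d (n+1) n ≫ b = 0), a = b → P.extMk a (n+1) rfl ha = P.extMk b (n+1) rfl hb := by
      intro a b ha hb h; subst h; rfl
    rw [RingHom.id_apply, Ext.smul_eq_comp_mk₀]
    exact (h3 _ _ h2 (by rw [← h1]; exact h2) h1).trans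
      (P.extMk_comp_mk₀ f.1 (n+1) rfl hf (r • 𝟙 Y)).symm

noncomputable def cocB {X : ModuleCat.{u} R} (P : ProjectiveResolution X) (Y : ModuleCat.{u} R) (n : ℕ) :
    coc P Y n →ₗ[R] ExtMod R n X Y where
  toFun f := (ERel_exists P n Y f.1 f.2).choose
  map_add' f g := ERel_inj P n Y _ _ _ (ERel_exists P n Y (f + g).1 (f + g).2).choose_spec
    (ERel_add _ _ _ _ _ _ _ (ERel_exists P n Y f.1 f.2).choose_spec
       (ERel_exists P n Y g.1 g.2).choose_spec)
  map_smul' r f := ERel_inj P n Y _ _ _ (ERel_exists P n Y (r • f).1 (r • f).2).choose_spec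
    (ERel_smul _ _ _ _ _ _ (ERel_exists P n Y f.1 f.2).choose_spec)

lemma ext_finite_iff (X Y : ModuleCat.{u} R) (n : ℕ) :
    Module.Finite R (ExtMod R n X Y) ↔ Module.Finite R (Abelian.Ext X Y n) := by
  let P := projectiveResolution X
  have hA : Function.Surjective (cocA P Y n) := by
    intro e
    obtain ⟨f, hf, rfl⟩ := P.extMk_surjective e (n+1) rfl
    exact ⟨⟨f, hf⟩, rfl⟩
  have hB : Function.Surjective (cocB P Y n) := by
    intro e
    obtain ⟨f, hf, h⟩ := ERel_surj P n Y e
    exact ⟨⟨f, hf⟩, ERel_inj P n Y _ _ f (ERel_exists P n Y f hf).choose_spec h⟩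
  have hk : LinearMap.ker (cocA P Y n) = LinearMap.ker (cocB P Y n) := by
    ext f
    rw [LinearMap.mem_ker, LinearMap.mem_ker]
    exact (extMk_zero_iff' P Y n f.1 f.2).trans
      (ERel_zero_iff P n Y _ _ (ERel_exists P n Y f.1 f.2).choose_spec).symm
  let e := (LinearMap.quotKerEquivOfSurjective _ hA).symm ≪≫ₗ
    (Submodule.quotEquivOfEq _ _ hk) ≪≫ₗ (LinearMap.quotKerEquivOfSurjective _ hB)
  exact ⟨fun h => Module.Finite.equiv e.symm, fun h => Module.Finite.equiv e⟩

lemma lc_vanish (I : Ideal R) (i : ℕ) (Y : ModuleCat.{u} R) (h : Subsingleton (LC R I i Y))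
    (n : ℕ) (e : Abelian.Ext (ModuleCat.of R (R ⧸ I ^ n)) Y i) :
    ∃ (m : ℕ) (hm : n ≤ m), (Ext.mk₀ (ModuleCat.ofHom
      (Submodule.factor (Ideal.pow_le_pow_right hm : I ^ m ≤ I ^ n)))).comp e (zero_add i) = 0 := by
  let D := localCohomology.diagram (localCohomology.idealPowersDiagram I) i
  let D' := D ⋙ (evaluation _ _).obj Y
  let P (n : ℕ) := projectiveResolution (ModuleCat.of R (R ⧸ I ^ n))
  obtain ⟨f, hf, rfl⟩ := (P n).extMk_surjective e (i+1) rfl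
  obtain ⟨c, hc⟩ := ERel_exists (P n) i Y f hf
  have hs : Subsingleton ↑(colimit D') := by
    let iso : (localCohomology I i).obj Y ≅ colimit D' := colimitObjIsoColimitCompEvaluation D Y
    exact (iso.toLinearEquiv.toEquiv.subsingleton_congr).1 h
  have h0 : (colimit.ι D' (Opposite.op (Opposite.op n))).hom c =
    (colimit.ι D' (Opposite.op (Opposite.op n))).hom 0 := Subsingleton.elim _ _
  have : PreservesFilteredColimitsOfSize.{0, 0} (forget (ModuleCat.{u} R)) :=
    preservesFilteredColimitsOfSize_shrink.{0, u, 0, u} _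
  have : PreservesColimitsOfShape ℕᵒᵖᵒᵖ (forget (ModuleCat.{u} R)) :=
    PreservesFilteredColimitsOfSize.preserves_filtered_colimits _
  obtain ⟨k, g, g', hg⟩ := Concrete.colimit_exists_of_rep_eq D' _ _ h0
  have hnm : n ≤ k.unop.unop := g.unop.unop.le
  let m := k.unop.unop
  refine ⟨m, hnm, ?_⟩
  let q : ModuleCat.of R (R ⧸ I ^ m) ⟶ ModuleCat.of R (R ⧸ I ^ n) := ModuleCat.ofHom
      (Submodule.factor (Ideal.pow_le_pow_right hnm : I ^ m ≤ I ^ n))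
  have hg2 : (((Ext R (ModuleCat.{u} R) i).map q.op).app Y).hom c = 0 := by
    refine Eq.trans ?_ (hg.trans (map_zero _))
    rfl
  let φ : ProjectiveResolution.Hom (P m) (P n) q :=
    { hom := ProjectiveResolution.lift q (P m) (P n)
      hom_f_zero_comp_π_f_zero := by
        exact HomologicalComplex.congr_hom (ProjectiveResolution.lift_commutes q (P m) (P n)) 0 }
  have h4 := ERel_nat (P n) (P m) i Y q φ c f hc
  have h5 := (ERel_zero_iff _ _ _ _ _ h4).1 hg2
  have h6 : (P m).complex.d (i+1) i ≫ φ.hom.f i ≫ f = 0 := by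
    rw [← Category.assoc, ← φ.hom.comm, Category.assoc, hf, comp_zero]
  have h7 := (extMk_zero_iff' (P m) Y i _ h6).2 h5
  rw [← h7]
  exact ProjectiveResolution.mk₀_comp_extMk _ _ _ _ φ
end bridge2

section api

variable (R : Type u) [CommRing R]

/-- Ext groups of modules (types) -/
abbrev EE (i : ℕ) (A B : Type u) [AddCommGroup A] [Module R A] [AddCommGroup B] [Module R B] :=
  Abelian.Ext (ModuleCat.of R A) (ModuleCat.of R B) i

variable {R}
variable {A A' A'' B B' C C' X Y : Type u}
  [AddCommGroup A] [Module R A] [AddCommGroup A'] [Module R A'] [AddCommGroup A''] [Module R A'']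
  [AddCommGroup B] [Module R B] [AddCommGroup B'] [Module R B']
  [AddCommGroup C] [Module R C] [AddCommGroup C'] [Module R C']
  [AddCommGroup X] [Module R X] [AddCommGroup Y] [Module R Y]

noncomputable def pull (f : A' →ₗ[R] A) (i : ℕ) (B : Type u) [AddCommGroup B] [Module R B] :
    EE R i A B →ₗ[R] EE R i A' B :=
  (Ext.mk₀ (ModuleCat.ofHom f)).precompOfLinear R _ (zero_add i)

noncomputable def push (A : Type u) [AddCommGroup A] [Module R A] (i : ℕ) (g : B →ₗ[R] B') :
    EE R i A B →ₗ[R] EE R i A B' :=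
  (Ext.mk₀ (ModuleCat.ofHom g)).postcompOfLinear R _ (add_zero i)

lemma pull_def (f : A' →ₗ[R] A) (i : ℕ) (e : EE R i A B) :
    pull f i B e = (Ext.mk₀ (ModuleCat.ofHom f)).comp e (zero_add i) := rfl

lemma push_def (g : B →ₗ[R] B') (i : ℕ) (e : EE R i A B) :
    push A i g e = e.comp (Ext.mk₀ (ModuleCat.ofHom g)) (add_zero i) := rfl

lemma pull_pull (f : A' →ₗ[R] A) (f' : A'' →ₗ[R] A') (i : ℕ) (e : EE R i A B) :
    pull f' i B (pull f i B e) = pull (f ∘ₗ f') i B e := by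
  simp only [pull_def]
  rw [← Ext.comp_assoc (a₁₂ := 0) _ _ _ (by lia) (by lia) (by lia), Ext.mk₀_comp_mk₀]
  rfl

lemma pull_push (f : A' →ₗ[R] A) (g : B →ₗ[R] B') (i : ℕ) (e : EE R i A B) :
    pull f i B' (push A i g e) = push A' i g (pull f i B e) := by
  simp only [pull_def, push_def]
  rw [Ext.comp_assoc (a₂₃ := i) _ _ _ (by lia) (by lia) (by lia)]

lemma pull_add (f f' : A' →ₗ[R] A) (i : ℕ) (e : EE R i A B) :
    pull (f + f') i B e = pull f i B e + pull f' i B e := by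
  simp only [pull_def]
  rw [← Ext.add_comp, ← Ext.mk₀_add]; rfl

lemma pull_zero (i : ℕ) (e : EE R i A B) :
    pull (0 : A' →ₗ[R] A) i B e = 0 := by
  simp only [pull_def]
  have : ModuleCat.ofHom (0 : A' →ₗ[R] A) = 0 := rfl
  rw [this, Ext.mk₀_zero, Ext.zero_comp]

lemma push_zero (i : ℕ) (e : EE R i A B) :
    push A i (0 : B →ₗ[R] B') e = 0 := by
  simp only [push_def]
  have : ModuleCat.ofHom (0 : B →ₗ[R] B') = 0 := rfl
  rw [this, Ext.mk₀_zero, Ext.comp_zero]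

lemma pull_smul_id (r : R) (i : ℕ) (e : EE R i A B) :
    pull (r • (LinearMap.id : A →ₗ[R] A)) i B e = r • e := by
  simp only [pull_def]
  have : ModuleCat.ofHom (r • (LinearMap.id : A →ₗ[R] A)) = r • 𝟙 _ := rfl
  rw [this, Ext.mk₀_smul, Ext.smul_comp, Ext.mk₀_id_comp]

lemma pull_id (i : ℕ) (e : EE R i A B) :
    pull (LinearMap.id : A →ₗ[R] A) i B e = e := Ext.mk₀_id_comp e

lemma push_smul_id (r : R) (i : ℕ) (e : EE R i A B) :
    push A i (r • (LinearMap.id : B →ₗ[R] B)) e = r • e := by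
  simp only [push_def]
  have : ModuleCat.ofHom (r • (LinearMap.id : B →ₗ[R] B)) = r • 𝟙 _ := rfl
  rw [this, Ext.mk₀_smul, Ext.comp_smul, Ext.comp_mk₀_id]

lemma push_push {B'' : Type u} [AddCommGroup B''] [Module R B''] (g : B →ₗ[R] B')
    (g' : B' →ₗ[R] B'') (i : ℕ) (e : EE R i A B) :
    push A i g' (push A i g e) = push A i (g' ∘ₗ g) e := by
  simp only [push_def]
  rw [Ext.comp_assoc (a₂₃ := 0) _ _ _ (by lia) (by lia) (by lia), Ext.mk₀_comp_mk₀]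
  rfl

lemma smul_zero_of_ann (r : R) (h : ∀ a : A, r • a = 0) (i : ℕ) (e : EE R i A B) : r • e = 0 := by
  rw [← pull_smul_id]
  have : r • (LinearMap.id : A →ₗ[R] A) = 0 := by ext a; exact h a
  rw [this, pull_zero]

/-- short exact sequence data -/
structure SES (f : A →ₗ[R] B) (g : B →ₗ[R] C) : Prop where
  inj : Function.Injective f
  ex : Function.Exact f g
  surj : Function.Surjective g

/-- the short complex -/
abbrev SES.sc {f : A →ₗ[R] B} {g : B →ₗ[R] C} (h : SES f g) : ShortComplex (ModuleCat.{u} R) :=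
  ShortComplex.mk (ModuleCat.ofHom f) (ModuleCat.ofHom g)
    (by ext x; exact (h.ex (f x)).2 ⟨x, rfl⟩)

lemma SES.se {f : A →ₗ[R] B} {g : B →ₗ[R] C} (h : SES f g) : h.sc.ShortExact :=
  ModuleCat.shortComplex_shortExact h.sc h.ex h.inj h.surj

noncomputable def SES.dC {f : A →ₗ[R] B} {g : B →ₗ[R] C} (h : SES f g) (i : ℕ) (Y : Type u)
    [AddCommGroup Y] [Module R Y] : EE R i A Y →ₗ[R] EE R (i+1) C Y :=
  h.se.extClass.precompOfLinear R (ModuleCat.of R Y) (add_comm 1 i)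

noncomputable def SES.dK {f : A →ₗ[R] B} {g : B →ₗ[R] C} (h : SES f g) (X : Type u)
    [AddCommGroup X] [Module R X] (i : ℕ) : EE R i X C →ₗ[R] EE R (i+1) X A :=
  h.se.extClass.postcompOfLinear R (ModuleCat.of R X) rfl

section
variable {f : A →ₗ[R] B} {g : B →ₗ[R] C} (h : SES f g) {i : ℕ}
include h

lemma SES.c1 (e : EE R i A Y) (he : h.dC i Y e = 0) : ∃ e', pull f i Y e' = e :=
  Ext.contravariant_sequence_exact₁ h.se (ModuleCat.of R Y) e (add_comm 1 i) he
lemma SES.c2 (e : EE R i B Y) (he : pull f i Y e = 0) : ∃ e', pull g i Y e' = e :=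
  Ext.contravariant_sequence_exact₂ h.se (ModuleCat.of R Y) e he
lemma SES.c3 (e : EE R (i+1) C Y) (he : pull g (i+1) Y e = 0) : ∃ e', h.dC i Y e' = e :=
  Ext.contravariant_sequence_exact₃ h.se (ModuleCat.of R Y) e he (add_comm 1 i)
lemma SES.k1 (e : EE R (i+1) X A) (he : push X (i+1) f e = 0) : ∃ e', h.dK X i e' = e :=
  Ext.covariant_sequence_exact₁ (ModuleCat.of R X) h.se e he rfl
lemma SES.k2 (e : EE R i X B) (he : push X i g e = 0) : ∃ e', push X i f e' = e :=
  Ext.covariant_sequence_exact₂ (ModuleCat.of R X) h.se e he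
lemma SES.k3 (e : EE R i X C) (he : h.dK X i e = 0) : ∃ e', push X i g e' = e :=
  Ext.covariant_sequence_exact₃ (ModuleCat.of R X) h.se e rfl he

lemma SES.push_dK (e : EE R i X C) : push X (i+1) f (h.dK X i e) = 0 :=
  (Ext.comp_assoc (a₁₂ := i+1) (a₂₃ := 1) e h.se.extClass (Ext.mk₀ (ModuleCat.ofHom f))
    (by lia) (by lia) (by lia)).trans
    ((congrArg (fun t => Ext.comp e t rfl) h.se.extClass_comp).trans (Ext.comp_zero _ _ _ _ _))

lemma SES.dK_push (e : EE R i X B) : h.dK X i (push X i g e) = 0 :=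
  (Ext.comp_assoc (a₁₂ := i) (a₂₃ := 1) e (Ext.mk₀ (ModuleCat.ofHom g)) h.se.extClass
    (by lia) (by lia) (by lia)).trans
    ((congrArg (fun t => Ext.comp e t rfl) h.se.comp_extClass).trans (Ext.comp_zero _ _ _ _ _))

lemma SES.dC_pull (e : EE R i B Y) : h.dC i Y (pull f i Y e) = 0 :=
  h.se.extClass_comp_assoc (h := add_comm 1 i) e

lemma SES.pull_dC (e : EE R i A Y) : pull g (i+1) Y (h.dC i Y e) = 0 :=
  h.se.comp_extClass_assoc e (add_comm 1 i)

lemma SES.dK_pull (a : X →ₗ[R] Y) (e : EE R i Y C) : pull a (i+1) A (h.dK Y i e) = h.dK X i (pull a i C e) :=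
  (Ext.comp_assoc (a₁₂ := i) (a₂₃ := i+1) _ _ _ (by lia) (by lia) (by lia)).symm

lemma SES.dC_push (a : X →ₗ[R] Y) (e : EE R i A X) : push C (i+1) a (h.dC i X e) = h.dC i Y (push A i a e) :=
  (Ext.comp_assoc (a₁₂ := i+1) (a₂₃ := i) _ _ _ (by lia) (by lia) (by lia))

lemma SES.dC_nat {f' : A' →ₗ[R] B'} {g' : B' →ₗ[R] C'} (h' : SES f' g')
    (α : A' →ₗ[R] A) (β : B' →ₗ[R] B) (γ : C' →ₗ[R] C) (h1 : f ∘ₗ α = β ∘ₗ f') (h2 : g ∘ₗ β = γ ∘ₗ g')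
    (e : EE R i A Y) : pull γ (i+1) Y (h.dC i Y e) = h'.dC i Y (pull α i Y e) := by
  let t : h'.sc ⟶ h.sc := 
    { τ₁ := ModuleCat.ofHom α
      τ₂ := ModuleCat.ofHom β
      τ₃ := ModuleCat.ofHom γ
      comm₁₂ := by ext x; exact LinearMap.congr_fun h1 x
      comm₂₃ := by ext x; exact LinearMap.congr_fun h2 x }
  have := ShortComplex.ShortExact.extClass_naturality h'.se h.se t
  have e1 := Ext.comp_assoc (a₁₂ := 1) (a₂₃ := i+1) (a := i+1) (Ext.mk₀ (ModuleCat.ofHom γ)) h.se.extClass e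
    (by lia) (by lia) (by lia)
  have e2 := Ext.comp_assoc (a₁₂ := 1) (a₂₃ := i) (a := i+1) h'.se.extClass (Ext.mk₀ (ModuleCat.ofHom α)) e
    (by lia) (by lia) (by lia)
  exact e1.symm.trans ((congrArg (fun t => Ext.comp t e (add_comm 1 i)) this.symm).trans e2)

end

lemma ee_proj [Module.Projective R A] (i : ℕ) (e : EE R (i+1) A B) : e = 0 := by
  have : Projective (ModuleCat.of R A) := inferInstance
  exact Ext.eq_zero_of_projective e

/-- degree zero -/
noncomputable def ee0 : EE R 0 A B ≃ₗ[R] (A →ₗ[R] B) :=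
  Ext.linearEquiv₀.trans ModuleCat.homLinearEquiv

lemma ee0_symm (f : A →ₗ[R] B) : ee0.symm f = Ext.mk₀ (ModuleCat.ofHom f) := rfl

lemma ee0_pull (a : A' →ₗ[R] A) (e : EE R 0 A B) : ee0 (pull a 0 B e) = ee0 e ∘ₗ a := by
  obtain ⟨f, rfl⟩ := ee0.symm.surjective e
  rw [LinearEquiv.apply_symm_apply, ← LinearEquiv.eq_symm_apply, ee0_symm, ee0_symm, pull_def, Ext.mk₀_comp_mk₀]
  rfl

lemma ee0_push (a : B →ₗ[R] B') (e : EE R 0 A B) : ee0 (push A 0 a e) = a ∘ₗ ee0 e := by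
  obtain ⟨f, rfl⟩ := ee0.symm.surjective e
  rw [LinearEquiv.apply_symm_apply, ← LinearEquiv.eq_symm_apply, ee0_symm, ee0_symm, push_def, Ext.mk₀_comp_mk₀]
  rfl

lemma ses_ker (f : A →ₗ[R] B) (hf : Function.Surjective f) : SES (LinearMap.ker f).subtype f :=
  ⟨Subtype.val_injective, fun x => by simp, hf⟩

lemma ses_quot (S : Submodule R A) : SES S.subtype S.mkQ :=
  ⟨Subtype.val_injective, fun x => by simp, S.mkQ_surjective⟩

end api

section vanish

variable {R : Type u} [CommRing R] (I : Ideal R)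

/-- the quotient maps -/
def qf {m n : ℕ} (h : n ≤ m) : (R ⧸ I ^ m) →ₗ[R] (R ⧸ I ^ n) :=
  Submodule.factor (Ideal.pow_le_pow_right h)

/-- direct limit vanishing -/
def PP (i : ℕ) (N : Type u) [AddCommGroup N] [Module R N] : Prop :=
  ∀ n, ∀ e : EE R i (R ⧸ I ^ n) N, ∃ (m : ℕ) (h : n ≤ m), pull (qf I h) i N e = 0

lemma qf_comp {a b c : ℕ} (h : a ≤ b) (h' : b ≤ c) : qf I h ∘ₗ qf I h' = qf I (h.trans h') := by
  apply LinearMap.ext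
  intro x
  obtain ⟨x, rfl⟩ := Submodule.mkQ_surjective _ x
  rfl

variable {A B C : Type u}
  [AddCommGroup A] [Module R A] [AddCommGroup B] [Module R B] [AddCommGroup C] [Module R C]

lemma PP_ext {f : A →ₗ[R] B} {g : B →ₗ[R] C} (h : SES f g) (i : ℕ) (hA : PP I i A) (hC : PP I i C) :
    PP I i B := by
  intro n e
  obtain ⟨m, hm, h1⟩ := hC n (push _ i g e)
  rw [pull_push] at h1
  obtain ⟨e', he'⟩ := h.k2 _ h1
  obtain ⟨m', hm', h2⟩ := hA m e'
  refine ⟨m', hm.trans hm', ?_⟩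
  rw [← qf_comp I hm hm', ← pull_pull, ← he', pull_push, h2, map_zero]

lemma PP_next {f : A →ₗ[R] B} {g : B →ₗ[R] C} (h : SES f g) (i : ℕ) (hA : PP I (i+1) A) (hB : PP I i B) :
    PP I i C := by
  intro n e
  obtain ⟨m, hm, h1⟩ := hA n (h.dK _ i e)
  rw [h.dK_pull] at h1
  obtain ⟨e', he'⟩ := h.k3 _ h1
  obtain ⟨m', hm', h2⟩ := hB m e'
  refine ⟨m', hm.trans hm', ?_⟩
  rw [← qf_comp I hm hm', ← pull_pull, ← he', pull_push, h2, map_zero]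

lemma PP_free (i : ℕ) (h : PP I i R) (k : ℕ) : PP I i (Fin k → R) := by
  induction k with
  | zero =>
    intro n e
    refine ⟨n, le_rfl, ?_⟩
    have : push (R ⧸ I ^ n) i (0 : (Fin 0 → R) →ₗ[R] (Fin 0 → R)) e = e := by
      have h0 : (0 : (Fin 0 → R) →ₗ[R] (Fin 0 → R)) = (1 : R) • LinearMap.id := Subsingleton.elim _ _
      rw [h0, push_smul_id, one_smul]
    rw [← this, push_zero, map_zero]
  | succ k ih =>
    have hs : SES (LinearMap.single R (fun _ : Fin (k+1) => R) 0) (LinearMap.funLeft R R (Fin.succ : Fin k → _)) := by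
      refine ⟨fun a b hab => ?_, fun v => ?_, fun v => ?_⟩
      · simpa using congrFun hab 0
      · constructor
        · intro hv
          refine ⟨v 0, ?_⟩
          funext j
          refine Fin.cases ?_ (fun j => ?_) j
          · simp
          · have := congrFun hv j
            simp [LinearMap.funLeft] at this
            simp [this]
        · rintro ⟨a, rfl⟩
          funext j
          simp [LinearMap.funLeft]
      · exact ⟨Fin.cons 0 v, by funext j; simp [LinearMap.funLeft]⟩
    exact PP_ext I hs i h ih

variable [IsNoetherianRing R]

lemma tors_kill (T : Type u) [AddCommGroup T] [Module R T] (c : ℕ) (hT : ∀ a ∈ I ^ c, ∀ t : T, a • t = 0)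
    (i : ℕ) : ∀ (M : Type u) [AddCommGroup M] [Module R M] [Module.Finite R M],
      ∃ k : ℕ, ∀ e : EE R i M T, pull (I ^ k • (⊤ : Submodule R M)).subtype i T e = 0 := by
  induction i with
  | zero =>
    intro M _ _ _
    refine ⟨c, fun e => ?_⟩
    apply ee0.injective
    rw [ee0_pull, map_zero]
    ext ⟨x, hx⟩
    simp only [LinearMap.comp_apply, Submodule.subtype_apply, LinearMap.zero_apply]
    induction hx using Submodule.smul_induction_on' with
    | smul a ha y hy => rw [map_smul, hT a ha]
    | add x _ y _ h1 h2 => rw [map_add, h1, h2, add_zero]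
  | succ i ih =>
    intro M _ _ _
    obtain ⟨F, _, _, _, _, p, hp⟩ := Module.exists_finite_presentation R M
    obtain ⟨k0, hk0⟩ := ih (LinearMap.ker p)
    obtain ⟨k1, hk1⟩ := I.exists_pow_inf_eq_pow_smul (LinearMap.ker p)
    refine ⟨k0 + k1, fun e => ?_⟩
    have hs := ses_ker p hp
    obtain ⟨e0, rfl⟩ := hs.c3 e (ee_proj i _)
    let p' : (I ^ (k0 + k1) • (⊤ : Submodule R F) : Submodule R F) →ₗ[R]
        (I ^ (k0 + k1) • (⊤ : Submodule R M) : Submodule R M) :=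
      p.restrict (fun x hx => by
        have := Submodule.mem_map_of_mem (f := p) hx
        rw [Submodule.map_smul''] at this
        exact Submodule.smul_mono le_rfl le_top this)
    have hp' : Function.Surjective p' := by
      rintro ⟨y, hy⟩
      have h1 : (I ^ (k0 + k1) • (⊤ : Submodule R M) : Submodule R M) = 
        Submodule.map p (I ^ (k0 + k1) • (⊤ : Submodule R F)) := by
        rw [Submodule.map_smul'', Submodule.map_top, LinearMap.range_eq_top.2 hp]
      rw [h1] at hy
      obtain ⟨x, hx, rfl⟩ := hy
      exact ⟨⟨x, hx⟩, rfl⟩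
    have hs' := ses_ker p' hp'
    let α : LinearMap.ker p' →ₗ[R] LinearMap.ker p := 
      LinearMap.restrict (p := LinearMap.ker p') (Submodule.subtype _) (fun x hx => by
        have : p' x = 0 := hx
        exact congrArg Subtype.val this)
    have hα : ∀ z, α z ∈ I ^ k0 • (⊤ : Submodule R (LinearMap.ker p)) := by
      intro z
      have h1 : (z.1.1 : F) ∈ I ^ (k0 + k1) • (⊤ : Submodule R F) ⊓ LinearMap.ker p := 
        ⟨z.1.2, (α z).2⟩
      rw [hk1 _ (by lia), Nat.add_sub_cancel] at h1
      have h2 : (z.1.1 : F) ∈ I ^ k0 • LinearMap.ker p := Submodule.smul_mono le_rfl inf_le_right h1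
      have h3 : I ^ k0 • LinearMap.ker p = Submodule.map (LinearMap.ker p).subtype (I ^ k0 • ⊤) := by
        rw [Submodule.map_smul'', Submodule.map_top, Submodule.range_subtype]
      rw [h3] at h2
      obtain ⟨w, hw, hw2⟩ := h2
      have : w = α z := Subtype.ext hw2
      rwa [← this]
    rw [hs.dC_nat hs' α (Submodule.subtype _) _ rfl rfl]
    have h5 : α = (I ^ k0 • (⊤ : Submodule R (LinearMap.ker p))).subtype ∘ₗ α.codRestrict _ hα := rfl
    rw [h5, ← pull_pull, hk0, map_zero, map_zero]

/-- inclusion of powers -/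
def incl {m n : ℕ} (h : n ≤ m) : (I ^ m : Ideal R) →ₗ[R] (I ^ n : Ideal R) :=
  Submodule.inclusion (Ideal.pow_le_pow_right h)

omit [IsNoetherianRing R] in
lemma qnat {n m : ℕ} (h : n ≤ m) (i : ℕ) (e : EE R i (I ^ n : Ideal R) A) :
    pull (qf I h) (i+1) A ((ses_quot (I ^ n)).dC i A e) = 
     (ses_quot (I ^ m)).dC i A (pull (incl I h) i A e) :=
  SES.dC_nat (ses_quot (I ^ n)) (ses_quot (I ^ m)) (incl I h) LinearMap.id (qf I h)
    (by ext x; rfl) (by ext; rfl) e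

lemma PP_tors (T : Type u) [AddCommGroup T] [Module R T] (c : ℕ) (hT : ∀ a ∈ I ^ c, ∀ t : T, a • t = 0)
    (i : ℕ) : PP I (i+1) T := by
  intro n e
  obtain ⟨e0, rfl⟩ := (ses_quot (I ^ n)).c3 e (ee_proj i _)
  obtain ⟨k, hk⟩ := tors_kill I T c hT i (I ^ n : Ideal R)
  refine ⟨k + n, by lia, ?_⟩
  rw [qnat]
  have hα : ∀ z, incl I (show n ≤ k + n by lia) z ∈ I ^ k • (⊤ : Submodule R (I ^ n : Ideal R)) := by
    intro z
    have h2 : (z : R) ∈ I ^ k • (I ^ n) := by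
      rw [smul_eq_mul, ← pow_add]; exact z.2
    have h3 : I ^ k • (I ^ n) = Submodule.map (Submodule.subtype (I ^ n)) (I ^ k • ⊤) := by
      rw [Submodule.map_smul'', Submodule.map_top, Submodule.range_subtype]
    rw [h3] at h2
    obtain ⟨w, hw, hw2⟩ := h2
    have : w = incl I (show n ≤ k + n by lia) z := Subtype.ext hw2
    rwa [← this]
  have h5 : incl I (show n ≤ k + n by lia) = 
    (I ^ k • (⊤ : Submodule R (I ^ n : Ideal R))).subtype ∘ₗ (incl I (by lia)).codRestrict _ hα := rfl
  rw [h5, ← pull_pull, hk, map_zero, map_zero]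

end vanish

section vanish2

variable {R : Type u} [CommRing R] [IsNoetherianRing R] (I : Ideal R)

lemma PP_large (s : Finset R) (hs : ∀ x ∈ s, x ∈ I) :
    ∀ (N : Type u) [AddCommGroup N] [Module R N] [Module.Finite R N],
      I ≤ (Module.annihilator R N ⊔ Ideal.span (s : Set R)).radical →
      ∀ i, s.card < i → PP I i N := by
  classical
  induction s using Finset.induction_on with
  | empty =>
    intro N _ _ _ h i hi
    obtain ⟨i, rfl⟩ : ∃ j, i = j + 1 := ⟨i - 1, by simp at hi; lia⟩
    simp only [Finset.coe_empty, Ideal.span_empty, sup_bot_eq] at h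
    obtain ⟨c, hc⟩ := Ideal.exists_pow_le_of_le_radical_of_fg h (IsNoetherian.noetherian I)
    exact PP_tors I N c (fun a ha t => Module.mem_annihilator.1 (hc ha) t) i
  | insert x s hx ih =>
    intro N _ _ _ h i hi
    have ih := ih (fun y hy => hs y (Finset.mem_insert_of_mem hy))
    have hxI : x ∈ I := hs x (Finset.mem_insert_self _ _)
    rw [Finset.card_insert_of_notMem hx] at hi
    have key : ∀ (L : Type u) [AddCommGroup L] [Module R L] (a : ℕ),
      Module.annihilator R N ≤ Module.annihilator R L → x ^ a ∈ Module.annihilator R L →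
        I ≤ (Module.annihilator R L ⊔ Ideal.span (s : Set R)).radical := by
      intro L _ _ a h1 h2
      refine h.trans ?_
      rw [Ideal.radical_le_radical_iff]
      refine sup_le (h1.trans (le_sup_left.trans Ideal.le_radical)) ?_
      rw [Ideal.span_le]
      intro y hy
      rw [Finset.coe_insert, Set.mem_insert_iff] at hy
      rcases hy with rfl | hy
      · exact ⟨a, Submodule.mem_sup_left h2⟩
      · exact Ideal.le_radical (Submodule.mem_sup_right (Ideal.subset_span hy))
    obtain ⟨i, rfl⟩ : ∃ j, i = j + 1 := ⟨i - 1, by lia⟩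
    let μ : N →ₗ[R] N := LinearMap.lsmul R N x
    have hμ : ∀ (a : ℕ) y, (μ ^ a) y = x ^ a • y := by
      intro a y
      have : μ ^ a = LinearMap.lsmul R N (x ^ a) := by
        simp only [μ]
        exact (map_pow (Module.toModuleEnd R N : R →+* _) x a).symm
      rw [this]; rfl
    have := LinearMap.eventually_iSup_ker_pow_eq μ
    obtain ⟨a, ha⟩ := Filter.eventually_atTop.1 this
    have hst : ∀ b (y : N), x ^ (a + b) • y = 0 → x ^ a • y = 0 := by
      intro b y hy
      have e1 : LinearMap.ker (μ ^ a) = LinearMap.ker (μ ^ (a + b)) := by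
        rw [← ha a le_rfl, ← ha (a+b) (by lia)]
      have : y ∈ LinearMap.ker (μ ^ (a + b)) := by
        rw [LinearMap.mem_ker, hμ]; exact hy
      rw [← e1, LinearMap.mem_ker, hμ] at this
      exact this
    let ν : N →ₗ[R] N := LinearMap.lsmul R N (x ^ a)
    have hν : ∀ y, ν y = x ^ a • y := fun y => rfl
    refine PP_ext I (ses_ker ν.rangeRestrict ν.surjective_rangeRestrict) _ ?_ ?_
    · apply ih _ (key _ a _ _) _ (by lia)
      · exact LinearMap.annihilator_le_of_injective _ (Submodule.subtype_injective _)
      · rw [Module.mem_annihilator]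
        rintro ⟨y, hy⟩
        rw [LinearMap.ker_rangeRestrict] at hy
        exact Subtype.ext hy
    · intro n e
      let σ : LinearMap.range ν →ₗ[R] LinearMap.range ν := x ^ n • LinearMap.id
      have hσ : Function.Injective σ := by
        rw [injective_iff_map_eq_zero]
        rintro ⟨_, y, rfl⟩ hy
        have h1 : x ^ n • x ^ a • y = 0 := congrArg Subtype.val hy
        apply Subtype.ext
        change x ^ a • y = 0
        apply hst n
        rw [smul_smul] at h1
        rw [add_comm, pow_add]
        exact h1
      have S : SES σ (LinearMap.range σ).mkQ := 
        ⟨hσ, fun y => by simp, Submodule.mkQ_surjective _⟩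
      have h0 : push (R ⧸ I ^ n) (i+1) σ e = 0 := by
        rw [push_smul_id]
        apply smul_zero_of_ann
        intro b
        obtain ⟨b, rfl⟩ := Submodule.mkQ_surjective _ b
        rw [← map_smul]
        simp only [Submodule.mkQ_apply, Submodule.Quotient.mk_eq_zero]
        exact Ideal.mul_mem_right _ _ (Ideal.pow_mem_pow hxI n)
      obtain ⟨e', rfl⟩ := S.k1 e h0
      have : PP I i (LinearMap.range ν ⧸ LinearMap.range σ) := by
        apply ih _ (key _ n _ _) _ (by lia)
        · exact (LinearMap.annihilator_le_of_injective _ (Submodule.subtype_injective (LinearMap.range ν))).trans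
            (LinearMap.annihilator_le_of_surjective _ (Submodule.mkQ_surjective _))
        · rw [Module.mem_annihilator]
          intro b
          obtain ⟨b, rfl⟩ := Submodule.mkQ_surjective _ b
          rw [← map_smul]
          simp only [Submodule.mkQ_apply, Submodule.Quotient.mk_eq_zero]
          exact ⟨b, rfl⟩
      obtain ⟨m, hm, h3⟩ := this n e'
      exact ⟨m, hm, by rw [S.dK_pull, h3, map_zero]⟩

lemma PP_all (hR : ∀ i, 2 ≤ i → PP I i R) (i : ℕ) (hi : 2 ≤ i) (N : Type u) [AddCommGroup N] [Module R N]
    [Module.Finite R N] : PP I i N := by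
  obtain ⟨s, hs⟩ := IsNoetherian.noetherian I
  suffices ∀ d i, s.card < i + d → 2 ≤ i → ∀ (N : Type u) [AddCommGroup N] [Module R N]
    [Module.Finite R N], PP I i N from this (s.card + 1) i (by lia) hi N
  intro d
  induction d with
  | zero =>
    intro i h1 h2 N _ _ _
    refine PP_large I s (fun x hx => ?_) N ?_ i (by lia)
    · rw [← hs]; exact Submodule.subset_span hx
    · refine le_trans ?_ Ideal.le_radical
      refine le_trans ?_ le_sup_right
      exact hs.ge
  | succ d ih =>
    intro i h1 h2 N _ _ _
    obtain ⟨k, f, hf⟩ := Module.Finite.exists_fin' R N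
    exact PP_next I (ses_ker f hf) i (ih (i+1) (by lia) (by lia) _) (PP_free I i (hR i h2) k)

lemma exists_phi (hR : ∀ i, 2 ≤ i → PP I i R) : ∃ (r : ℕ) (x : Fin r → R) (n : ℕ) (φ : Fin r → ((I ^ n : Ideal R) →ₗ[R] R)),
    1 ≤ n ∧ Ideal.span (Set.range x) = I ∧ ∀ a : (I ^ n : Ideal R), ∑ i, φ i a * x i = a := by
  obtain ⟨r, π, hπ⟩ := Module.Finite.exists_fin' R (I ^ 1 : Ideal R)
  have S := ses_ker π hπ
  let e0 := S.dK (I ^ 1 : Ideal R) 0 (ee0.symm LinearMap.id)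
  let e := (ses_quot (I ^ 1)).dC 1 _ e0
  obtain ⟨n, hn, h⟩ := PP_all I hR 2 le_rfl (LinearMap.ker π) 1 e
  simp only [e] at h
  rw [qnat] at h
  obtain ⟨e2, he2⟩ := (ses_quot (I ^ n)).c1 _ h
  rw [ee_proj 0 e2, map_zero] at he2
  simp only [e0] at he2
  rw [S.dK_pull] at he2
  obtain ⟨ψ, hψ⟩ := S.k3 _ he2.symm
  have h6 := congrArg ee0 hψ
  rw [ee0_pull, ee0_push, LinearEquiv.apply_symm_apply, LinearMap.id_comp] at h6
  let bas : Fin r → (Fin r → R) := fun i => Pi.single i 1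
  have hsum : ∀ v : Fin r → R, ((π v : (I ^ 1 : Ideal R)) : R) = ∑ i, v i * (π (bas i) : R) := by
    intro v
    conv_lhs => rw [pi_eq_sum_univ' v]
    simp [bas]
  refine ⟨r, fun i => (π (bas i) : R), n, fun i => LinearMap.proj i ∘ₗ ee0 ψ, hn, ?_, fun a => ?_⟩
  · apply le_antisymm
    · rw [Ideal.span_le]
      rintro _ ⟨i, rfl⟩
      exact (pow_one I).le (π (bas i)).2
    · intro y hy
      obtain ⟨v, hv⟩ := hπ ⟨y, by rwa [pow_one]⟩
      have h7 := hsum v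
      rw [hv] at h7
      change y = _ at h7
      rw [h7]
      exact Ideal.sum_mem _ (fun i _ => Ideal.mul_mem_left _ _ (Ideal.subset_span ⟨i, rfl⟩))
  · have h7 := congrArg Subtype.val (LinearMap.congr_fun h6 a)
    exact (hsum _).symm.trans h7

end vanish2

section fin

variable {R : Type u} [CommRing R] [IsNoetherianRing R]

lemma fin_of {A B C : Type*} [AddCommGroup A] [Module R A] [AddCommGroup B] [Module R B]
    [AddCommGroup C] [Module R C] (f : A →ₗ[R] B) (g : B →ₗ[R] C) (h : ∀ b, g b = 0 → ∃ a, f a = b)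
    (hA : Module.Finite R A) (hg : (LinearMap.range g).FG) : Module.Finite R B := by
  refine ⟨Submodule.fg_of_fg_map_of_fg_inf_ker g ?_ ?_⟩
  · rwa [Submodule.map_top]
  · rw [top_inf_eq]
    have h1 : LinearMap.ker g ≤ LinearMap.range f := fun b hb => h b hb
    have h2 : (⊤ : Submodule R A).FG := hA.1
    have h3 : (LinearMap.range f).FG := by rw [← Submodule.map_top]; exact h2.map f
    exact h3.of_le h1

lemma fin_of2 {A B C : Type*} [AddCommGroup A] [Module R A] [AddCommGroup B] [Module R B]
    [AddCommGroup C] [Module R C] (f : A →ₗ[R] B) (g : B →ₗ[R] C) (h : ∀ b, g b = 0 → ∃ a, f a = b)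
    (hA : Module.Finite R A) (hC : Module.Finite R C) : Module.Finite R B :=
  fin_of f g h hA (IsNoetherian.noetherian _)

lemma fin_inj {B C : Type*} [AddCommGroup B] [Module R B]
    [AddCommGroup C] [Module R C] (g : B →ₗ[R] C) (h : Function.Injective g)
    (hC : Module.Finite R C) : Module.Finite R B := Module.Finite.of_injective g h

lemma fin_range {A B C : Type*} [AddCommGroup A] [Module R A] [AddCommGroup B] [Module R B]
    [AddCommGroup C] [Module R C] (v : A →ₗ[R] B) (l : A →ₗ[R] C) (h : ∀ a, v a = 0 → l a = 0)
    (hB : Module.Finite R B) : (LinearMap.range l).FG := by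
  have h1 : Module.Finite R (A ⧸ LinearMap.ker v) := Module.Finite.equiv v.quotKerEquivRange.symm
  have h' : LinearMap.ker v ≤ LinearMap.ker l := h
  have h2 : LinearMap.range l = LinearMap.range ((LinearMap.ker v).liftQ l h') := by
    rw [Submodule.range_liftQ]
  rw [h2, ← Submodule.map_top]
  exact h1.1.map _

lemma exists_fg_sup {M : Type*} [AddCommGroup M] [Module R M] (K : Submodule R M)
    (h : Module.Finite R (M ⧸ K)) : ∃ S : Submodule R M, S.FG ∧ S ⊔ K = ⊤ := by
  obtain ⟨k, f, hf⟩ := Module.Finite.exists_fin' R (M ⧸ K)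
  obtain ⟨g, hg⟩ := Module.projective_lifting_property K.mkQ f K.mkQ_surjective
  refine ⟨LinearMap.range g, ?_, ?_⟩
  · rw [← Submodule.map_top]
    exact (IsNoetherian.noetherian _).map g
  · rw [eq_top_iff]
    intro m _
    obtain ⟨v, hv⟩ := hf (K.mkQ m)
    rw [← hg] at hv
    have : m - g v ∈ K := by
      rw [← Submodule.ker_mkQ K, LinearMap.mem_ker, map_sub, ← hv]; simp
    rw [← sub_add_cancel m (g v), add_comm]
    exact Submodule.add_mem_sup ⟨v, rfl⟩ this

lemma fin_quot {M : Type*} [AddCommGroup M] [Module R M] (K S : Submodule R M)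
    (hS : S.FG) (h : S ⊔ K = ⊤) : Module.Finite R (M ⧸ K) := by
  have h1 := hS.map K.mkQ
  have : Submodule.map K.mkQ S = ⊤ := by
    have h2 := congrArg (Submodule.map K.mkQ) h
    rw [Submodule.map_sup, Submodule.map_top, Submodule.range_mkQ] at h2
    have h3 : Submodule.map K.mkQ K = ⊥ := by
      rw [eq_bot_iff, Submodule.map_le_iff_le_comap]; intro y hy; simpa using hy
    rwa [h3, sup_bot_eq] at h2
  exact ⟨this ▸ h1⟩

variable (I : Ideal R) (M : Type u) [AddCommGroup M] [Module R M]

/-- finite cosocle -/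
def HG : Prop := ∃ S : Submodule R M, S.FG ∧ S ⊔ I • ⊤ = ⊤

omit [IsNoetherianRing R] in
lemma HG_pow (S : Submodule R M) (h : S ⊔ I • ⊤ = ⊤) (n : ℕ) : S ⊔ I ^ n • ⊤ = ⊤ := by
  induction n with
  | zero => simp
  | succ n ih =>
    rw [eq_top_iff]
    conv_lhs => rw [← h]
    refine sup_le le_sup_left ?_
    conv_lhs => rw [← ih]
    rw [Submodule.smul_sup, ← Submodule.mul_smul, ← pow_succ']
    exact sup_le (Submodule.smul_le_right.trans le_sup_left) le_sup_right

/-- finiteness for all torsion test modules -/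
def QT (i : ℕ) : Prop := ∀ (T : Type u) [AddCommGroup T] [Module R T] [Module.Finite R T] (c : ℕ),
  (∀ a ∈ I ^ c, ∀ t : T, a • t = 0) → Module.Finite R (EE R i T M)

lemma fin_c3 {A B C : Type u} [AddCommGroup A] [Module R A] [AddCommGroup B] [Module R B]
    [AddCommGroup C] [Module R C] {f : A →ₗ[R] B} {g : B →ₗ[R] C} (S : SES f g) (i : ℕ)
    (h1 : Module.Finite R (EE R i B M)) (h2 : ∀ j, i = j + 1 → Module.Finite R (EE R j A M)) :
    Module.Finite R (EE R i C M) := by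
  cases i with
  | zero =>
    refine fin_inj (pull g 0 M) ?_ h1
    rw [injective_iff_map_eq_zero]
    intro e he
    have h3 := congrArg ee0 he
    rw [ee0_pull, map_zero] at h3
    apply ee0.injective
    rw [map_zero]
    ext c
    obtain ⟨b, rfl⟩ := S.surj c
    exact LinearMap.congr_fun h3 b
  | succ i => exact fin_of2 (S.dC i M) (pull g (i+1) M) (fun e he => S.c3 e he) (h2 i rfl) h1

lemma QT_step (i : ℕ) (h1 : Module.Finite R (EE R i (R ⧸ I) M)) (h2 : ∀ j, i = j + 1 → QT I M j) :
    QT I M i := by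
  intro T _ _ hT
  induction hT using IsNoetherianRing.induction_on_isQuotientEquivQuotientPrime R with
  | subsingleton N =>
    intro c hc
    have : Subsingleton (EE R i N M) := by
      refine subsingleton_of_forall_eq 0 (fun e => ?_)
      rw [← pull_id i e]
      have : (LinearMap.id : N →ₗ[R] N) = 0 := Subsingleton.elim _ _
      rw [this, pull_zero]
    infer_instance
  | quotient N p f =>
    intro c hc
    have hI : I ≤ p.asIdeal := by
      have h3 : I ^ c ≤ p.asIdeal := by
        intro a ha
        have h4 := hc a ha (f.symm (Submodule.mkQ p.asIdeal 1))
        rw [← map_smul, LinearEquiv.map_eq_zero_iff, ← map_smul, Submodule.mkQ_apply,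
          Submodule.Quotient.mk_eq_zero] at h4
        simpa using h4
      exact p.2.le_of_pow_le h3
    let g : (R ⧸ I) →ₗ[R] N := f.symm.toLinearMap ∘ₗ Submodule.factor hI
    have hg : Function.Surjective g := f.symm.surjective.comp (Submodule.factor_surjective hI)
    refine fin_c3 M (ses_ker g hg) i h1 (fun j hj => ?_)
    refine h2 j hj _ 1 ?_
    rintro a ha ⟨t, ht⟩
    rw [pow_one] at ha
    apply Subtype.ext
    obtain ⟨t, rfl⟩ := Submodule.mkQ_surjective _ t
    change a • Submodule.mkQ I t = 0
    rw [← map_smul, Submodule.mkQ_apply, Submodule.Quotient.mk_eq_zero]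
    exact Ideal.mul_mem_right _ _ ha
  | exact N₁ N₂ N₃ f g hf hg hfg ih1 ih3 =>
    intro c hc
    have S : SES f g := ⟨hf, hfg, hg⟩
    refine fin_of2 (pull g i M) (pull f i M) (fun e he => S.c2 e he) (ih3 c ?_) (ih1 c ?_)
    · intro a ha t
      obtain ⟨t, rfl⟩ := hg t
      rw [← map_smul, hc a ha, map_zero]
    · intro a ha t
      apply hf
      rw [map_smul, hc a ha, map_zero]

omit [IsNoetherianRing R] in
lemma qnat2 {J K : Ideal R} (h : J ≤ K) (i : ℕ) (e : EE R i K M) :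
    pull (Submodule.factor h) (i+1) M ((ses_quot K).dC i M e) = 
     (ses_quot J).dC i M (pull (Submodule.inclusion h) i M e) :=
  SES.dC_nat (ses_quot K) (ses_quot J) (Submodule.inclusion h) LinearMap.id (Submodule.factor h)
    (by ext x; rfl) (by ext; rfl) e

omit [IsNoetherianRing R] in
lemma inner_zero (J : Ideal R) (e : EE R 0 J M) :
    (ses_quot J).dC 0 M e = 0 ↔ ∃ m : M, ∀ a : J, ee0 e a = (a : R) • m := by
  constructor
  · intro h
    obtain ⟨e', rfl⟩ := (ses_quot J).c1 e h
    refine ⟨ee0 e' 1, fun a => ?_⟩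
    rw [ee0_pull, LinearMap.comp_apply, ← map_smul, smul_eq_mul, mul_one]; rfl
  · rintro ⟨m, hm⟩
    have : e = pull J.subtype 0 M (ee0.symm (LinearMap.toSpanSingleton R M m)) := by
      apply ee0.injective
      rw [ee0_pull, LinearEquiv.apply_symm_apply]
      ext a
      rw [hm]; rfl
    rw [this, SES.dC_pull]

variable {r n : ℕ} (x : Fin r → R) (φ : Fin r → ((I ^ n : Ideal R) →ₗ[R] R)) (hn : 1 ≤ n)
  (hx : Ideal.span (Set.range x) = I) (hφ : ∀ a : (I ^ n : Ideal R), ∑ i, φ i a * x i = a)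
include hn hx hφ

lemma ker_kill {i : ℕ} (hi : QT I M i) (h : I ^ n ≤ I) :
    Module.Finite R (EE R i (LinearMap.ker (Submodule.factor h)) M) := by
  refine hi _ n ?_
  rintro a ha ⟨t, ht⟩
  apply Subtype.ext
  obtain ⟨t, rfl⟩ := Submodule.mkQ_surjective _ t
  change a • Submodule.mkQ _ t = 0
  rw [← map_smul, Submodule.mkQ_apply, Submodule.Quotient.mk_eq_zero]
  exact Ideal.mul_mem_right _ _ ha

lemma Q_one (h0 : QT I M 0) (hG : HG I M) : Module.Finite R (EE R 1 (R ⧸ I) M) := by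
  have hle : I ^ n ≤ I := Ideal.pow_le_self (by lia)
  have S := ses_ker _ (Submodule.factor_surjective hle)
  obtain ⟨S0, hS0, hS1⟩ := hG
  have hfin : Module.Finite R (M ⧸ (I ^ n • ⊤ : Submodule R M)) :=
    fin_quot _ S0 hS0 (HG_pow I M S0 hS1 n)
  refine fin_of (S.dC 0 M) (pull (Submodule.factor hle) 1 M) (fun e he => S.c3 e he) 
    (ker_kill I M x φ hn hx hφ h0 hle) ?_
  have hxI : ∀ i, x i ∈ I := fun i => hx ▸ Ideal.subset_span ⟨i, rfl⟩
  let l : (I →ₗ[R] M) →ₗ[R] EE R 1 (R ⧸ I ^ n) M :=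
    (ses_quot (I ^ n)).dC 0 M ∘ₗ pull (Submodule.inclusion hle) 0 M ∘ₗ ee0.symm.toLinearMap
  let v : (I →ₗ[R] M) →ₗ[R] (Fin r → (M ⧸ (I ^ n • ⊤ : Submodule R M))) :=
    LinearMap.pi (fun i => Submodule.mkQ _ ∘ₗ LinearMap.applyₗ (⟨x i, hxI i⟩ : I))
  have key : (LinearMap.range l).FG := by
    refine fin_range v l (fun g hg => ?_) inferInstance
    have hg' : ∀ i, g ⟨x i, hxI i⟩ ∈ (I ^ n • ⊤ : Submodule R M) := by
      intro i
      have := congrFun hg i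
      rwa [← Submodule.Quotient.mk_eq_zero]
    have hin : ∀ i, ∀ y ∈ (I ^ n • ⊤ : Submodule R M), ∃ m : M, ∀ a : (I ^ n : Ideal R),
        φ i a • y = (a : R) • m := by
      intro i y hy
      induction hy using Submodule.smul_induction_on' with
      | smul c hc m hm =>
        refine ⟨φ i ⟨c, hc⟩ • m, fun a => ?_⟩
        rw [smul_smul, smul_smul]
        congr 1
        rw [mul_comm, ← smul_eq_mul, ← smul_eq_mul, ← map_smul, ← map_smul]
        congr 1
        exact Subtype.ext (mul_comm _ _)
      | add y1 _ y2 _ h1 h2 =>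
        obtain ⟨m1, h1⟩ := h1
        obtain ⟨m2, h2⟩ := h2
        exact ⟨m1 + m2, fun a => by rw [smul_add, smul_add, h1, h2]⟩
    choose m hm using fun i => hin i _ (hg' i)
    change (ses_quot (I ^ n)).dC 0 M _ = 0
    rw [inner_zero]
    refine ⟨∑ i, m i, fun a => ?_⟩
    rw [Finset.smul_sum]
    simp only [← hm]
    change ee0 (pull _ 0 M (ee0.symm g)) a = _
    rw [ee0_pull, LinearEquiv.apply_symm_apply, LinearMap.comp_apply]
    simp only [← map_smul, ← map_sum]
    congr 1
    apply Subtype.ext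
    simp only [Submodule.coe_inclusion, AddSubmonoidClass.coe_finsetSum, Submodule.coe_smul, smul_eq_mul]
    exact (hφ a).symm
  refine key.of_le ?_
  rintro _ ⟨e, rfl⟩
  obtain ⟨e', rfl⟩ := (ses_quot I).c3 e (ee_proj 0 _)
  rw [qnat2]
  exact ⟨ee0 e', by simp [l]⟩

lemma Q_succ (i : ℕ) (h0 : QT I M (i+1)) : Module.Finite R (EE R (i+2) (R ⧸ I) M) := by
  have hle : I ^ n ≤ I := Ideal.pow_le_self (by lia)
  have S := ses_ker _ (Submodule.factor_surjective hle)
  have := (ker_kill I M x φ hn hx hφ h0 hle)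
  refine Module.Finite.of_surjective (S.dC (i+1) M) (fun e => S.c3 e ?_)
  obtain ⟨e', rfl⟩ := (ses_quot I).c3 e (ee_proj (i+1) _)
  rw [qnat2]
  have hxI : ∀ i, x i ∈ I := fun i => hx ▸ Ideal.subset_span ⟨i, rfl⟩
  let π : (Fin r → R) →ₗ[R] I := Fintype.linearCombination R (fun i => (⟨x i, hxI i⟩ : I))
  have h1 : Submodule.inclusion hle = π ∘ₗ LinearMap.pi φ := by
    ext a
    simp only [Submodule.coe_inclusion, LinearMap.comp_apply, π, Fintype.linearCombination_apply,
      AddSubmonoidClass.coe_finsetSum, Submodule.coe_smul, smul_eq_mul, LinearMap.pi_apply]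
    exact (hφ a).symm
  rw [h1, ← pull_pull, ee_proj i (pull π (i+1) M e'), map_zero, map_zero]

lemma Q_all (h0 : Module.Finite R (EE R 0 (R ⧸ I) M)) (hG : HG I M) (i : ℕ) :
    Module.Finite R (EE R i (R ⧸ I) M) := by
  have : ∀ i, QT I M i := by
    intro i
    induction i with
    | zero => exact QT_step I M 0 h0 (by lia)
    | succ i ih =>
      refine QT_step I M (i+1) ?_ (fun j hj => by obtain rfl : i = j := by lia
                                                  exact ih)
      cases i with
      | zero => exact Q_one I M x φ hn hx hφ ih hG
      | succ i => exact Q_succ I M x φ hn hx hφ i ih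
  refine this i _ 1 ?_
  intro a ha t
  rw [pow_one] at ha
  obtain ⟨t, rfl⟩ := Submodule.mkQ_surjective _ t
  rw [← map_smul, Submodule.mkQ_apply, Submodule.Quotient.mk_eq_zero]
  exact Ideal.mul_mem_right _ _ ha

lemma HG_of (h0 : Module.Finite R (EE R 0 (R ⧸ I) M)) (h1 : Module.Finite R (EE R 1 (R ⧸ I) M)) :
    HG I M := by
  have q0 := QT_step I M 0 h0 (by lia)
  have q1 := QT_step I M 1 h1 (fun j hj => by obtain rfl : j = 0 := by lia
                                              exact q0)
  have hk : ∀ a ∈ I ^ n, ∀ t : R ⧸ I ^ n, a • t = 0 := by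
    intro a ha t
    obtain ⟨t, rfl⟩ := Submodule.mkQ_surjective _ t
    rw [← map_smul, Submodule.mkQ_apply, Submodule.Quotient.mk_eq_zero]
    exact Ideal.mul_mem_right _ _ ha
  have f0 := q0 (R ⧸ I ^ n) n hk
  have f1 := q1 (R ⧸ I ^ n) n hk
  have hxI : ∀ i, x i ∈ I := fun i => hx ▸ Ideal.subset_span ⟨i, rfl⟩
  let Ψ : M →ₗ[R] (Fin r → EE R 1 (R ⧸ I ^ n) M) := LinearMap.pi (fun i =>
    (ses_quot (I ^ n)).dC 0 M ∘ₗ ee0.symm.toLinearMap ∘ₗ LinearMap.smulRightₗ (φ i))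
  let D : Submodule R M := LinearMap.range 
    (LinearMap.applyₗ (Submodule.mkQ (I ^ n) 1) ∘ₗ (ee0 (R := R) (A := R ⧸ I ^ n) (B := M)).toLinearMap)
  have hD : D.FG := by
    simp only [D]
    rw [← Submodule.map_top]
    exact f0.1.map _
  have hΨ : LinearMap.ker Ψ ≤ D ⊔ I • ⊤ := by
    intro m hm
    have h2 : ∀ i, ∃ m' : M, ∀ a : (I ^ n : Ideal R), φ i a • m = (a : R) • m' := by
      intro i
      have h3 : (ses_quot (I ^ n)).dC 0 M (ee0.symm (LinearMap.smulRightₗ (φ i) m)) = 0 := congrFun hm i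
      rw [inner_zero] at h3
      obtain ⟨m', h3⟩ := h3
      refine ⟨m', fun a => ?_⟩
      rw [← h3, LinearEquiv.apply_symm_apply]; rfl
    choose m' hm' using h2
    have h4 : ∀ a ∈ I ^ n, a • (m - ∑ i, x i • m' i) = 0 := by
      intro a ha
      rw [smul_sub, Finset.smul_sum, sub_eq_zero]
      have h5 := hφ ⟨a, ha⟩
      change _ = a at h5
      conv_lhs => rw [← h5, Finset.sum_smul]
      refine Finset.sum_congr rfl (fun i _ => ?_)
      rw [mul_comm, mul_smul, hm', smul_comm]
    rw [← sub_add_cancel m (∑ i, x i • m' i)]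
    refine Submodule.add_mem_sup ?_ ?_
    · refine ⟨ee0.symm ((I ^ n : Ideal R).liftQ (LinearMap.toSpanSingleton R M _) 
        (fun a ha => h4 a ha)), ?_⟩
      rw [LinearMap.comp_apply, LinearEquiv.coe_coe, LinearEquiv.apply_symm_apply]
      exact one_smul R _
    · exact Submodule.sum_mem _ (fun i _ => Submodule.smul_mem_smul (hxI i) trivial)
  have hq : Module.Finite R (M ⧸ LinearMap.ker Ψ) := Module.Finite.equiv Ψ.quotKerEquivRange.symm
  obtain ⟨S, hS, hS'⟩ := exists_fg_sup _ hq
  refine ⟨S ⊔ D, hS.sup hD, ?_⟩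
  rw [eq_top_iff, sup_assoc]
  exact hS'.ge.trans (sup_le_sup_left hΨ S)

end fin

section final

variable {R : Type u} [CommRing R] [IsNoetherianRing R] (I : Ideal R)

lemma push_inj0 {A B B' : Type u} [AddCommGroup A] [Module R A] [AddCommGroup B] [Module R B]
    [AddCommGroup B'] [Module R B'] (g : B →ₗ[R] B') (hg : Function.Injective g) :
    Function.Injective (push (R := R) A 0 g) := by
  intro a b h
  have h1 := congrArg ee0 h
  rw [ee0_push, ee0_push] at h1
  apply ee0.injective
  apply LinearMap.ext
  intro x
  exact hg (LinearMap.congr_fun h1 x)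

lemma HG_map {M N : Type u} [AddCommGroup M] [Module R M] [AddCommGroup N] [Module R N]
    (f : M →ₗ[R] N) (hf : Function.Surjective f) (h : HG I M) : HG I N := by
  obtain ⟨S, hS, h⟩ := h
  refine ⟨S.map f, hS.map f, ?_⟩
  have h1 := congrArg (Submodule.map f) h
  rwa [Submodule.map_sup, Submodule.map_smul'', Submodule.map_top, LinearMap.range_eq_top.2 hf] at h1

theorem final_main
    (hcd : ∀ i : ℕ, 2 ≤ i → Subsingleton (LC R I i (ModuleCat.of R R)))
    (M N : Type u) [AddCommGroup M] [Module R M] [AddCommGroup N] [Module R N]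
    (hM : IsCofinite R I (ModuleCat.of R M)) (hN : IsCofinite R I (ModuleCat.of R N))
    (f : M →ₗ[R] N) :
    IsCofinite R I (ModuleCat.of R (LinearMap.ker f)) ∧
      IsCofinite R I (ModuleCat.of R (N ⧸ LinearMap.range f)) := by
  have hR : ∀ i, 2 ≤ i → PP I i R := fun i hi n e => lc_vanish I i _ (hcd i hi) n e
  obtain ⟨r, x, n, φ, hn, hx, hφ⟩ := exists_phi I hR
  have eM : ∀ i, Module.Finite R (EE R i (R ⧸ I) M) := fun i => (ext_finite_iff _ _ i).1 (hM.2 i)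
  have eN : ∀ i, Module.Finite R (EE R i (R ⧸ I) N) := fun i => (ext_finite_iff _ _ i).1 (hN.2 i)
  have gM := HG_of I M x φ hn hx hφ (eM 0) (eM 1)
  have eI : ∀ i, Module.Finite R (EE R i (R ⧸ I) (LinearMap.range f)) := by
    refine Q_all I _ x φ hn hx hφ ?_ ?_
    · exact fin_inj _ (push_inj0 (LinearMap.range f).subtype (Submodule.injective_subtype _)) (eN 0)
    · exact HG_map I f.rangeRestrict f.surjective_rangeRestrict gM
  have S1 : SES (LinearMap.ker f).subtype f.rangeRestrict := by
    have := ses_ker f.rangeRestrict f.surjective_rangeRestrict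
    rwa [LinearMap.ker_rangeRestrict] at this
  have S2 := ses_quot (LinearMap.range f)
  refine ⟨⟨?_, fun i => (ext_finite_iff _ _ i).2 ?_⟩, ⟨?_, fun i => (ext_finite_iff _ _ i).2 ?_⟩⟩
  · exact (Module.support_subset_of_injective (LinearMap.ker f).subtype
      (Submodule.injective_subtype _)).trans hM.1
  · cases i with
    | zero => exact fin_inj _ (push_inj0 (LinearMap.ker f).subtype (Submodule.injective_subtype _)) (eM 0)
    | succ i => exact fin_of2 (S1.dK _ i) (push _ (i+1) (LinearMap.ker f).subtype)
                  (fun e he => S1.k1 e he) (eI i) (eM (i+1))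
  · exact (Module.support_subset_of_surjective (LinearMap.range f).mkQ
      (Submodule.mkQ_surjective _)).trans hN.1
  · exact fin_of2 (push _ i (LinearMap.range f).mkQ) (S2.dK _ i)
      (fun e he => S2.k3 e he) (eN i) (eI (i+1))

end final

end mine

theorem stmt5 (R : Type u) [CommRing R] [IsNoetherianRing R] [IsLocalRing R] (I : Ideal R)
    (hcd : ∀ i : ℕ, 2 ≤ i → Subsingleton (LC R I i (ModuleCat.of R R)))
    (M N : Type u) [AddCommGroup M] [Module R M] [AddCommGroup N] [Module R N]
    (hM : IsCofinite R I (ModuleCat.of R M)) (hN : IsCofinite R I (ModuleCat.of R N))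
    (f : M →ₗ[R] N) :
    IsCofinite R I (ModuleCat.of R (LinearMap.ker f)) ∧
      IsCofinite R I (ModuleCat.of R (N ⧸ LinearMap.range f)) := 
  final_main I hcd M N hM hN f
end
end
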